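/- arXiv:math/0405179 — 2 statements merged into one kernel-verified Lean document; each statement's English description precedes it below -/
import Mathlib

section
/- Let φ be a ℂ-algebra endomorphism of ℂ[x,y] with invertible Jacobian matrix. If there exist a non-constant polynomial p ∈ ℂ[x,y] and an injective ℂ-algebra endomorphism ψ of ℂ[x,y] such that ψ(φ(p)) = p, then φ is an automorphism of ℂ[x,y]. -/
open MvPolynomial

/-- `ℂ[x,y]` as multivariate polynomials in two variables. -/
local notation "P" => MvPolynomial (Fin 2) ℂ

/-- The Jacobian determinant `D(u,v) = ∂ₓu·∂ᵧv − ∂ᵧu·∂ₓv`. -/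
noncomputable def jacDet (u v : P) : P :=
  pderiv (0 : Fin 2) u * pderiv (1 : Fin 2) v -
    pderiv (1 : Fin 2) u * pderiv (0 : Fin 2) v

theorem totalDegree_pderiv_le (i : Fin 2) (h : P) :
    (pderiv i h).totalDegree ≤ h.totalDegree - 1 := by
  refine Finset.sup_le fun s hs => ?_
  rw [mem_support_iff, coeff_pderiv] at hs
  have h1 := le_totalDegree (mem_support_iff.mpr (left_ne_zero_of_mul hs))
  have h2 : ((s + Finsupp.single i 1).sum fun _ e => e) = (s.sum fun _ e => e) + 1 := by
    rw [Finsupp.sum_add_index' (by simp) (by simp)]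
    simp
  omega

theorem totalDegree_pos_of_pderiv_ne_zero {i : Fin 2} {h : P} (hi : pderiv i h ≠ 0) :
    0 < h.totalDegree := by
  by_contra h0
  rw [totalDegree_eq_zero_iff_eq_C.mp (by omega : h.totalDegree = 0)] at hi
  exact hi pderiv_C

theorem totalDegree_pos_of_jacDet_ne_zero {f g : P} (h : jacDet f g ≠ 0) :
    0 < f.totalDegree ∧ 0 < g.totalDegree := by
  by_cases h1 : pderiv (0 : Fin 2) f * pderiv (1 : Fin 2) g = 0
  · have h2 : pderiv (1 : Fin 2) f * pderiv (0 : Fin 2) g ≠ 0 := by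
      intro h2; apply h; rw [jacDet, h1, h2, sub_zero]
    exact ⟨totalDegree_pos_of_pderiv_ne_zero (left_ne_zero_of_mul h2),
      totalDegree_pos_of_pderiv_ne_zero (right_ne_zero_of_mul h2)⟩
  · exact ⟨totalDegree_pos_of_pderiv_ne_zero (left_ne_zero_of_mul h1),
      totalDegree_pos_of_pderiv_ne_zero (right_ne_zero_of_mul h1)⟩

theorem totalDegree_jacDet_add_two_le {f g : P} (h : jacDet f g ≠ 0) :
    (jacDet f g).totalDegree + 2 ≤ f.totalDegree + g.totalDegree := by
  have hpos := totalDegree_pos_of_jacDet_ne_zero h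
  have h1 := totalDegree_sub (pderiv (0 : Fin 2) f * pderiv (1 : Fin 2) g)
    (pderiv (1 : Fin 2) f * pderiv (0 : Fin 2) g)
  have h2 := totalDegree_mul (pderiv (0 : Fin 2) f) (pderiv (1 : Fin 2) g)
  have h3 := totalDegree_mul (pderiv (1 : Fin 2) f) (pderiv (0 : Fin 2) g)
  have := totalDegree_pderiv_le 0 f
  have := totalDegree_pderiv_le 1 f
  have := totalDegree_pderiv_le 0 g
  have := totalDegree_pderiv_le 1 g
  rw [← jacDet] at h1
  omega

theorem pderiv_algHom_apply (ψ : P →ₐ[ℂ] P) (i : Fin 2) (F : P) :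
    pderiv i (ψ F) =
      ψ (pderiv 0 F) * pderiv i (ψ (X 0)) + ψ (pderiv 1 F) * pderiv i (ψ (X 1)) := by
  induction F using MvPolynomial.induction_on with
  | C a => simp [← algebraMap_eq]
  | add p q hp hq => simp only [map_add, hp, hq]; ring
  | mul_X p j hp =>
    simp only [map_mul, Derivation.leibniz, smul_eq_mul, hp, map_add]
    fin_cases j <;> simp [pderiv_X] <;> ring

theorem jacDet_algHom_apply (ψ : P →ₐ[ℂ] P) (F G : P) :
    jacDet (ψ F) (ψ G) = ψ (jacDet F G) * jacDet (ψ (X 0)) (ψ (X 1)) := by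
  simp only [jacDet, pderiv_algHom_apply ψ _ F, pderiv_algHom_apply ψ _ G, map_sub, map_mul]
  ring

theorem homogeneousComponent_add_mul {a b : ℕ} {f g : P} (hf : f.totalDegree ≤ a)
    (hg : g.totalDegree ≤ b) :
    homogeneousComponent (a + b) (f * g) =
      homogeneousComponent a f * homogeneousComponent b g := by
  ext d
  rw [coeff_homogeneousComponent, coeff_mul, coeff_mul]
  split_ifs with hd
  · refine Finset.sum_congr rfl fun x hx => ?_
    rw [coeff_homogeneousComponent, coeff_homogeneousComponent]
    have hsum : x.1.degree + x.2.degree = a + b := by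
      rw [← hd, ← Finset.HasAntidiagonal.mem_antidiagonal.mp hx, map_add]
    rcases lt_trichotomy x.1.degree a with h | h | h
    · rw [if_neg h.ne, zero_mul, coeff_eq_zero_of_totalDegree_lt (f := g), mul_zero]
      have : x.2.degree = ∑ i ∈ x.2.support, x.2 i := rfl
      omega
    · rw [if_pos h, if_pos (by omega)]
    · rw [if_neg h.ne', zero_mul, coeff_eq_zero_of_totalDegree_lt (f := f), zero_mul]
      have : x.1.degree = ∑ i ∈ x.1.support, x.1 i := rfl
      omega
  · refine (Finset.sum_eq_zero fun x hx => ?_).symm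
    rw [coeff_homogeneousComponent, coeff_homogeneousComponent]
    split_ifs with h1 h2
    · exact absurd (by rw [← Finset.HasAntidiagonal.mem_antidiagonal.mp hx, map_add, h1, h2]) hd
    all_goals simp

theorem homogeneousComponent_mul_pow {a : ℕ} {f : P} (hf : f.totalDegree ≤ a) (n : ℕ) :
    homogeneousComponent (a * n) (f ^ n) = homogeneousComponent a f ^ n := by
  induction n with
  | zero => simp [homogeneousComponent_zero]
  | succ n ih =>
    rw [pow_succ, pow_succ, ← ih, Nat.mul_succ, homogeneousComponent_add_mul _ hf]
    exact (totalDegree_pow _ _).trans (by rw [mul_comm]; gcongr)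

theorem homogeneousComponent_totalDegree_ne_zero {f : P} (hf : f ≠ 0) :
    homogeneousComponent f.totalDegree f ≠ 0 := by
  obtain ⟨s, hs, hd⟩ := Finset.exists_mem_eq_sup f.support (support_nonempty.mpr hf)
    (fun s => s.sum fun _ e => e)
  intro h
  have := congrArg (coeff s) h
  rw [coeff_homogeneousComponent, if_pos (show s.degree = f.totalDegree from hd.symm),
    coeff_zero] at this
  exact mem_support_iff.mp hs this

theorem totalDegree_lt_of_homogeneousComponent_eq_zero {f : P} {n : ℕ} (hn : 0 < n)
    (hf : f.totalDegree ≤ n) (h : homogeneousComponent n f = 0) : f.totalDegree < n := by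
  refine lt_of_le_of_ne hf fun he => ?_
  subst he
  refine homogeneousComponent_totalDegree_ne_zero ?_ h
  rintro rfl
  simp at hn

theorem derivation_eq_zero_of_isAlgebraic (D : Derivation ℂ P P) (S : Subalgebra ℂ P)
    (hS : ∀ s ∈ S, D s = 0) (a : P) (ha : IsAlgebraic S a) : D a = 0 := by
  have key : ∀ q : Polynomial S,
      D (Polynomial.aeval a q) = Polynomial.aeval a (Polynomial.derivative q) * D a := by
    intro q
    induction q using Polynomial.induction_on' with
    | add p q hp hq => simp only [map_add, hp, hq]; ring
    | monomial n s =>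
      have hs : D (algebraMap S P s) = 0 := hS s s.2
      rw [Polynomial.derivative_monomial, Polynomial.aeval_monomial, Polynomial.aeval_monomial,
        Derivation.leibniz, Derivation.leibniz_pow, hs, map_mul, map_natCast]
      simp only [smul_eq_mul, nsmul_eq_mul]
      ring
  obtain ⟨q₀, hq₀, haq₀⟩ := ha
  by_contra hD
  suffices h : ∀ n : ℕ, ∀ q : Polynomial S, q.natDegree = n → Polynomial.aeval a q = 0 → q = 0 from
    hq₀ (h _ q₀ rfl haq₀)
  intro n
  induction n using Nat.strong_induction_on with
  | _ n ih =>
    intro q hn hq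
    have h1 : Polynomial.aeval a (Polynomial.derivative q) = 0 := by
      have := key q
      rw [hq, map_zero] at this
      exact (mul_eq_zero.mp this.symm).resolve_right hD
    by_cases h0 : q.natDegree = 0
    · rw [Polynomial.eq_C_of_natDegree_eq_zero h0] at hq ⊢
      rw [Polynomial.aeval_C] at hq
      rw [(FaithfulSMul.algebraMap_eq_zero_iff S P).mp hq, Polynomial.C_0]
    · exact absurd (Polynomial.derivative_eq_zero.mp
        (ih _ (hn ▸ Polynomial.natDegree_derivative_lt h0) _ rfl h1)) h0

/-- The derivation `jacDet f`. -/
noncomputable def jacDerivation (f : P) : Derivation ℂ P P :=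
  pderiv (0 : Fin 2) f • pderiv (1 : Fin 2) - pderiv (1 : Fin 2) f • pderiv (0 : Fin 2)

theorem jacDerivation_apply (f g : P) : jacDerivation f g = jacDet f g := rfl

theorem eq_C_of_pderiv_eq_zero {f : P} (h : ∀ i, pderiv i f = 0) : ∃ c, f = C c := by
  refine ⟨coeff 0 f, ?_⟩
  ext s
  rw [coeff_C]
  split_ifs with hs
  · rw [hs]
  · obtain ⟨i, hi⟩ : ∃ i, s i ≠ 0 := by
      by_contra hne
      push Not at hne
      exact hs (Finsupp.ext fun i => (hne i).symm)
    have h1 := congrArg (coeff (s - Finsupp.single i 1)) (h i)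
    have h2 : s - Finsupp.single i 1 + Finsupp.single i 1 = s :=
      tsub_add_cancel_of_le (by simpa using Nat.one_le_iff_ne_zero.mpr hi)
    rw [coeff_pderiv, h2, coeff_zero] at h1
    exact (mul_eq_zero.mp h1).resolve_right (Nat.cast_add_one_ne_zero _)

theorem jacDet_ne_zero_of_injective {ψ : P →ₐ[ℂ] P} (hψ : Function.Injective ψ) :
    jacDet (ψ (X 0)) (ψ (X 1)) ≠ 0 := by
  intro h
  let x : Fin 2 → P := fun i => ψ (X i)
  have hx : AlgebraicIndependent ℂ x := by
    have : aeval x = ψ := by ext i; simp [x]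
    rw [AlgebraicIndependent, this]
    exact hψ
  have hbasis : IsTranscendenceBasis ℂ x :=
    hx.isTranscendenceBasis_of_lift_trdeg_le_of_finite (by simp [MvPolynomial.trdeg_of_isDomain])
  have halg := hbasis.isAlgebraic
  have hD : ∀ a, jacDerivation (ψ (X 0)) a = 0 := by
    intro a
    refine derivation_eq_zero_of_isAlgebraic _ _ ?_ a (halg.isAlgebraic a)
    intro s hs
    induction hs using Algebra.adjoin_induction with
    | mem y hy =>
      obtain ⟨i, rfl⟩ := hy
      fin_cases i
      · simp [jacDerivation_apply, jacDet, x]; ring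
      · exact h
    | algebraMap r => simp
    | add y z _ _ hy hz => simp [hy, hz]
    | mul y z _ _ hy hz => simp [hy, hz]
  obtain ⟨c, hc⟩ : ∃ c, ψ (X 0) = C c := by
    refine eq_C_of_pderiv_eq_zero fun i => ?_
    fin_cases i
    · simpa [jacDerivation_apply, jacDet, pderiv_X] using hD (X 1)
    · simpa [jacDerivation_apply, jacDet, pderiv_X] using hD (X 0)
  have : (X 0 : P) = C c := hψ (by rw [hc, ← algebraMap_eq, AlgHom.commutes])
  have := congrArg totalDegree this
  simp at this

theorem rootMultiplicity_lt_card_support {R : Type*} [CommRing R] [IsDomain R] [CharZero R]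
    {γ : R} (hγ : γ ≠ 0) {q : Polynomial R} (hq : q ≠ 0) :
    q.rootMultiplicity γ < q.support.card := by
  induction hn : q.natDegree using Nat.strong_induction_on generalizing q with
  | _ n ih =>
    subst hn
    by_cases hroot : q.IsRoot γ
    swap
    · rw [Polynomial.rootMultiplicity_eq_zero hroot]
      exact Finset.card_pos.mpr (Polynomial.support_nonempty.mpr hq)
    have hdeg : q.natDegree ≠ 0 := by
      intro h0
      rw [Polynomial.eq_C_of_natDegree_eq_zero h0, Polynomial.IsRoot, Polynomial.eval_C] at hroot
      exact hq (by rw [Polynomial.eq_C_of_natDegree_eq_zero h0, hroot, Polynomial.C_0])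
    by_cases h0 : q.coeff 0 = 0
    · obtain ⟨r, rfl⟩ := Polynomial.X_dvd_iff.mpr h0
      have hr : r ≠ 0 := right_ne_zero_of_mul hq
      have := ih r.natDegree (by rw [Polynomial.natDegree_X_mul hr]; omega) hr rfl
      rw [Polynomial.rootMultiplicity_mul hq]
      have hX : (Polynomial.X : Polynomial R).rootMultiplicity γ = 0 :=
        Polynomial.rootMultiplicity_eq_zero (by simpa [Polynomial.IsRoot] using hγ)
      have hcard : r.support.card ≤ (Polynomial.X * r).support.card :=
        Finset.card_le_card_of_injOn (· + 1) (fun j hj => by simpa using hj)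
          (fun a _ b _ h => by simpa using h)
      omega
    · have hd : Polynomial.derivative q ≠ 0 := fun h =>
        hdeg (Polynomial.derivative_eq_zero.mp h)
      have h1 := ih _ (Polynomial.natDegree_derivative_lt hdeg) hd rfl
      rw [Polynomial.derivative_rootMultiplicity_of_root hroot] at h1
      have h2 : (Polynomial.derivative q).support.card ≤ (q.support.erase 0).card := by
        refine Finset.card_le_card_of_injOn (· + 1) (fun j hj => ?_)
          (fun a _ b _ h => by simpa using h)
        simp only [Finset.mem_coe, Finset.mem_erase, Polynomial.mem_support_iff,
          Polynomial.coeff_derivative] at hj ⊢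
        exact ⟨by omega, left_ne_zero_of_mul hj⟩
      rw [Finset.card_erase_of_mem (Polynomial.mem_support_iff.mpr h0)] at h2
      omega

theorem aeval_cons_eq_sum {R : Type*} [CommRing R] [Algebra ℂ R] (f g : R) (F : P) :
    aeval ![f, g] F = ∑ s ∈ F.support, algebraMap ℂ R (coeff s F) * (f ^ s 0 * g ^ s 1) := by
  rw [aeval_def, eval₂_eq']
  simp [Fin.prod_univ_two]

theorem homogeneousComponent_aeval {f g : P} {m n w : ℕ} (hf : f.totalDegree ≤ m)
    (hg : g.totalDegree ≤ n) {A B : P} (hA : ∀ s ∈ A.support, m * s 0 + n * s 1 = w)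
    (hB : ∀ s ∈ B.support, m * s 0 + n * s 1 < w) :
    homogeneousComponent w (aeval ![f, g] (A + B)) =
      aeval ![homogeneousComponent m f, homogeneousComponent n g] A := by
  have hfi (i : ℕ) : (f ^ i).totalDegree ≤ m * i :=
    (totalDegree_pow _ _).trans (by rw [mul_comm]; gcongr)
  have hgi (i : ℕ) : (g ^ i).totalDegree ≤ n * i :=
    (totalDegree_pow _ _).trans (by rw [mul_comm]; gcongr)
  have h1 : homogeneousComponent w (aeval ![f, g] B) = 0 := by
    rw [aeval_cons_eq_sum, map_sum]
    refine Finset.sum_eq_zero fun s hs => ?_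
    rw [algebraMap_eq, homogeneousComponent_C_mul, homogeneousComponent_eq_zero, mul_zero]
    calc _ ≤ _ := totalDegree_mul _ _
      _ ≤ _ := add_le_add (hfi _) (hgi _)
      _ < w := hB s hs
  rw [map_add, map_add, h1, add_zero, aeval_cons_eq_sum, aeval_cons_eq_sum, map_sum]
  refine Finset.sum_congr rfl fun s hs => ?_
  rw [algebraMap_eq, homogeneousComponent_C_mul, ← hA s hs,
    homogeneousComponent_add_mul (hfi _) (hgi _), homogeneousComponent_mul_pow hf,
    homogeneousComponent_mul_pow hg]

/-- Substitute `f` for `x` and keep `y` as a variable. -/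
noncomputable def slice (f : P) : P →ₐ[ℂ] Polynomial P :=
  aeval ![Polynomial.C f, Polynomial.X]

theorem derivative_slice (f F : P) :
    Polynomial.derivative (slice f F) = slice f (pderiv 1 F) := by
  induction F using MvPolynomial.induction_on with
  | C a =>
    rw [pderiv_C, map_zero, ← algebraMap_eq, AlgHom.commutes]
    exact Polynomial.derivative_C
  | add p q hp hq => simp only [map_add, hp, hq]
  | mul_X p j hp =>
    rw [map_mul, Polynomial.derivative_mul, hp, Derivation.leibniz, smul_eq_mul, smul_eq_mul,
      map_add, map_mul, map_mul]
    fin_cases j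
    · simp [pderiv_X, slice, mul_comm]
    · simp [pderiv_X, slice]
      ring

theorem eval_slice (f g F : P) : (slice f F).eval g = aeval ![f, g] F := by
  have : ((Polynomial.aeval g : Polynomial P →ₐ[P] P).restrictScalars ℂ).comp (slice f) =
      aeval ![f, g] := by
    ext i
    fin_cases i <;> simp [slice]
  rw [← this]
  simp

theorem coeff_slice (f F : P) (j : ℕ) :
    (slice f F).coeff j = ∑ s ∈ F.support, if s 1 = j then C (coeff s F) * f ^ s 0 else 0 := by
  rw [slice, aeval_cons_eq_sum, Polynomial.finsetSum_coeff]
  refine Finset.sum_congr rfl fun s _ => ?_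
  rw [← Polynomial.C_pow, ← mul_assoc, IsScalarTower.algebraMap_apply ℂ P (Polynomial P),
    ← Polynomial.C_eq_algebraMap, ← Polynomial.C_mul, Polynomial.coeff_C_mul_X_pow, algebraMap_eq]
  simp only [eq_comm]

section WeightedHomogeneous

variable {m n w : ℕ} {A : P}

theorem eq_of_mem_support_of_apply_one_eq (hm : 0 < m)
    (hA : ∀ s ∈ A.support, m * s 0 + n * s 1 = w) {s t : Fin 2 →₀ ℕ} (hs : s ∈ A.support)
    (ht : t ∈ A.support) (h : s 1 = t 1) : s = t := by
  have h1 := hA s hs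
  have h2 := hA t ht
  rw [h] at h1
  have h3 : m * s 0 = m * t 0 := by omega
  ext i
  fin_cases i
  · exact Nat.eq_of_mul_eq_mul_left hm h3
  · exact h

theorem coeff_slice_of_mem_support (hm : 0 < m) (hA : ∀ s ∈ A.support, m * s 0 + n * s 1 = w)
    (f : P) {s : Fin 2 →₀ ℕ} (hs : s ∈ A.support) :
    (slice f A).coeff (s 1) = C (coeff s A) * f ^ s 0 := by
  rw [coeff_slice, Finset.sum_eq_single s, if_pos rfl]
  · exact fun t ht hts => if_neg fun h => hts (eq_of_mem_support_of_apply_one_eq hm hA ht hs h)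
  · exact fun h => absurd hs h

theorem slice_ne_zero (hm : 0 < m) (hA : ∀ s ∈ A.support, m * s 0 + n * s 1 = w)
    {f : P} (hf : f ≠ 0) (hA0 : A ≠ 0) : slice f A ≠ 0 := by
  obtain ⟨s, hs⟩ := support_nonempty.mpr hA0
  intro h
  have := coeff_slice_of_mem_support hm hA f hs
  rw [h, Polynomial.coeff_zero, eq_comm, mul_eq_zero] at this
  rcases this with h | h
  · exact mem_support_iff.mp hs (C_eq_zero.mp h)
  · exact pow_ne_zero _ hf h

theorem exists_mem_support_of_mem_support_slice {f : P} {j : ℕ}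
    (hj : j ∈ (slice f A).support) : ∃ s ∈ A.support, s 1 = j := by
  rw [Polynomial.mem_support_iff, coeff_slice] at hj
  obtain ⟨s, hs, h⟩ := Finset.exists_ne_zero_of_sum_ne_zero hj
  exact ⟨s, hs, by by_contra hne; simp [hne] at h⟩

/-- The exponents of `y` in a weighted homogeneous polynomial are congruent modulo
`m / gcd m n`, which bounds the multiplicity of a nonzero root of a slice. -/
theorem mul_rootMultiplicity_slice_le (hm : 0 < m)
    (hA : ∀ s ∈ A.support, m * s 0 + n * s 1 = w) {f g : P} (hf : f ≠ 0) (hg : g ≠ 0)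
    (hA0 : A ≠ 0) :
    n * (m / m.gcd n) * (slice f A).rootMultiplicity g ≤ w := by
  set q := slice f A with hq
  set t := m / m.gcd n with ht
  have hq0 : q ≠ 0 := slice_ne_zero hm hA hf hA0
  have hcard := rootMultiplicity_lt_card_support hg hq0
  have hgcd : 0 < m.gcd n := Nat.gcd_pos_of_pos_left _ hm
  have htpos : 0 < t := Nat.div_pos (Nat.le_of_dvd hm (Nat.gcd_dvd_left m n)) hgcd
  obtain ⟨s₀, hs₀, hj₀⟩ :=
    exists_mem_support_of_mem_support_slice (Polynomial.natDegree_mem_support_of_nonzero hq0)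
  have hmod : ∀ j ∈ q.support, j ≡ q.natDegree [MOD t] := by
    intro j hj
    obtain ⟨s, hs, rfl⟩ := exists_mem_support_of_mem_support_slice hj
    have h1 : n * s 1 ≡ n * s₀ 1 [MOD m] := by
      have e : m * s 0 + n * s 1 = m * s₀ 0 + n * s₀ 1 := (hA s hs).trans (hA s₀ hs₀).symm
      have e' : (m * s 0 + n * s 1) % m = (m * s₀ 0 + n * s₀ 1) % m := by rw [e]
      simpa [Nat.ModEq, Nat.mul_add_mod] using e'
    rw [← hj₀]
    exact Nat.ModEq.cancel_left_div_gcd hm h1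
  have hle : q.support.card ≤ q.natDegree / t + 1 := by
    rw [← Finset.card_range (q.natDegree / t + 1)]
    refine Finset.card_le_card_of_injOn (· / t) (fun j hj => ?_) (fun a ha b hb h => ?_)
    · simp only [Finset.coe_range, Set.mem_Iio, Nat.lt_succ_iff]
      exact Nat.div_le_div_right (Polynomial.le_natDegree_of_mem_supp j hj)
    · have h1 : a % t = b % t := (hmod a ha).trans (hmod b hb).symm
      have h2 : a / t = b / t := h
      rw [← Nat.div_add_mod a t, ← Nat.div_add_mod b t, h1, h2]
  calc n * t * q.rootMultiplicity g ≤ n * t * (q.natDegree / t) := by gcongr; omega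
    _ = n * (t * (q.natDegree / t)) := mul_assoc _ _ _
    _ ≤ n * q.natDegree := by gcongr; exact Nat.mul_div_le _ _
    _ ≤ w := by
      have := hA s₀ hs₀
      rw [hj₀, ← hq] at this
      omega

end WeightedHomogeneous

theorem exists_mem_support_of_mem_support_pderiv {F : P} {s : Fin 2 →₀ ℕ}
    (hs : s ∈ (pderiv 1 F).support) : s + Finsupp.single 1 1 ∈ F.support := by
  rw [mem_support_iff, coeff_pderiv] at hs
  exact mem_support_iff.mpr (left_ne_zero_of_mul hs)

/-- If the weighted leading part of `A + B` vanishes to order `k` at the leading forms of `f`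
and `g`, then at most `k * (deg f + deg g - 2)` is lost in degree on substituting `f` and `g`. -/
theorem weight_le_totalDegree_aeval {f g : P} (hJ : jacDet f g ≠ 0) (k : ℕ) :
    ∀ (w : ℕ) (A B : P),
      (∀ s ∈ A.support, f.totalDegree * s 0 + g.totalDegree * s 1 = w) →
      (∀ s ∈ B.support, f.totalDegree * s 0 + g.totalDegree * s 1 < w) → A ≠ 0 →
      (slice (homogeneousComponent f.totalDegree f) A).rootMultiplicity
        (homogeneousComponent g.totalDegree g) = k →
      aeval ![f, g] (A + B) ≠ 0 ∧ w + 2 * k ≤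
        (aeval ![f, g] (A + B)).totalDegree + k * (f.totalDegree + g.totalDegree) := by
  obtain ⟨hm, hn⟩ := totalDegree_pos_of_jacDet_ne_zero hJ
  have hf : f ≠ 0 := by rintro rfl; simp at hm
  induction k with
  | zero =>
    intro w A B hA hB hA0 hk
    have hq0 := slice_ne_zero hm hA (homogeneousComponent_totalDegree_ne_zero hf) hA0
    have hroot : ¬ (slice (homogeneousComponent f.totalDegree f) A).IsRoot
        (homogeneousComponent g.totalDegree g) := by
      intro h
      exact ((Polynomial.rootMultiplicity_pos hq0).mpr h).ne' hk
    rw [Polynomial.IsRoot, eval_slice, ← homogeneousComponent_aeval le_rfl le_rfl hA hB] at hroot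
    refine ⟨fun h => hroot (by rw [h, map_zero]), ?_⟩
    by_contra hlt
    exact hroot (homogeneousComponent_eq_zero _ _ (by omega))
  | succ k ih =>
    intro w A B hA hB hA0 hk
    have hq0 := slice_ne_zero hm hA (homogeneousComponent_totalDegree_ne_zero hf) hA0
    set q := slice (homogeneousComponent f.totalDegree f) A with hq
    have hroot : q.IsRoot (homogeneousComponent g.totalDegree g) :=
      (Polynomial.rootMultiplicity_pos hq0).mp (by omega)
    have hd0 : Polynomial.derivative q ≠ 0 := by
      intro h
      have h0 := Polynomial.derivative_eq_zero.mp h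
      rw [Polynomial.eq_C_of_natDegree_eq_zero h0, Polynomial.IsRoot, Polynomial.eval_C] at hroot
      exact hq0 (by rw [Polynomial.eq_C_of_natDegree_eq_zero h0, hroot, Polynomial.C_0])
    have hdA : pderiv 1 A ≠ 0 := by
      intro h
      rw [hq, derivative_slice, h, map_zero] at hd0
      exact hd0 rfl
    have hwt (s : Fin 2 →₀ ℕ) : f.totalDegree * (s + Finsupp.single 1 1 : Fin 2 →₀ ℕ) 0 +
        g.totalDegree * (s + Finsupp.single 1 1 : Fin 2 →₀ ℕ) 1 =
        f.totalDegree * s 0 + g.totalDegree * s 1 + g.totalDegree := by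
      simp
      ring
    have hA' : ∀ s ∈ (pderiv 1 A).support,
        f.totalDegree * s 0 + g.totalDegree * s 1 = w - g.totalDegree := by
      intro s hs
      have := hA _ (exists_mem_support_of_mem_support_pderiv hs)
      rw [hwt] at this
      omega
    have hB' : ∀ s ∈ (pderiv 1 B).support,
        f.totalDegree * s 0 + g.totalDegree * s 1 < w - g.totalDegree := by
      intro s hs
      have := hB _ (exists_mem_support_of_mem_support_pderiv hs)
      rw [hwt] at this
      omega
    obtain ⟨hne, hle⟩ := ih (w - g.totalDegree) (pderiv 1 A) (pderiv 1 B) hA' hB' hdA (by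
      rw [← derivative_slice, Polynomial.derivative_rootMultiplicity_of_root hroot, hk]
      omega)
    have hjac : jacDet f (aeval ![f, g] (A + B)) =
        aeval ![f, g] (pderiv 1 A + pderiv 1 B) * jacDet f g := by
      have := jacDet_algHom_apply (aeval ![f, g]) (X 0) (A + B)
      simpa [jacDet, pderiv_X] using this
    have hjac0 : jacDet f (aeval ![f, g] (A + B)) ≠ 0 := hjac ▸ mul_ne_zero hne hJ
    have h1 := totalDegree_jacDet_add_two_le hjac0
    rw [hjac, totalDegree_mul_of_isDomain hne hJ] at h1
    refine ⟨fun h => hjac0 (by rw [h]; simp [jacDet]), ?_⟩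
    rw [add_mul, one_mul]
    omega
/-- Homogeneous polynomials satisfying a nontrivial weighted homogeneous relation, where the
degree of the first divides the degree of the second, are a power of one another up to a scalar. -/
theorem exists_eq_C_mul_pow {F G A : P} (hF : F ≠ 0) {m q w : ℕ} (hm : 0 < m) (hA0 : A ≠ 0)
    (hA : ∀ s ∈ A.support, m * s 0 + m * q * s 1 = w) (h : aeval ![F, G] A = 0) :
    ∃ c, G = C c * F ^ q := by
  let K := FractionRing P
  let φ := algebraMap P K
  have hφ : Function.Injective φ := IsFractionRing.injective P K
  have hFK : φ F ≠ 0 := (map_ne_zero_iff φ hφ).mpr hF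
  let z : K := φ G / φ F ^ q
  let r : Polynomial ℂ := ∑ s ∈ A.support, Polynomial.C (coeff s A) * Polynomial.X ^ s 1
  obtain ⟨s₀, hs₀⟩ := support_nonempty.mpr hA0
  have hr : r ≠ 0 := by
    intro h0
    have h1 := congrArg (Polynomial.coeff · (s₀ 1)) h0
    simp only [r, Polynomial.finsetSum_coeff, Polynomial.coeff_C_mul_X_pow,
      Polynomial.coeff_zero] at h1
    rw [Finset.sum_eq_single s₀, if_pos rfl] at h1
    · exact mem_support_iff.mp hs₀ h1
    · exact fun t ht hts =>
        if_neg fun he => hts (eq_of_mem_support_of_apply_one_eq hm hA ht hs₀ he.symm)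
    · exact fun h => absurd hs₀ h
  have hexp : ∀ s ∈ A.support, s 0 + q * s 1 = s₀ 0 + q * s₀ 1 := fun s hs =>
    Nat.eq_of_mul_eq_mul_left hm (by
      rw [mul_add, mul_add, ← mul_assoc, ← mul_assoc, hA s hs, hA s₀ hs₀])
  have hz : Polynomial.aeval z r = 0 := by
    have h1 : φ F ^ (s₀ 0 + q * s₀ 1) * Polynomial.aeval z r = φ (aeval ![F, G] A) := by
      rw [aeval_cons_eq_sum, map_sum, map_sum, Finset.mul_sum]
      refine Finset.sum_congr rfl fun s hs => ?_
      rw [← hexp s hs, map_mul, map_mul, map_mul, map_pow, map_pow, map_pow, Polynomial.aeval_C,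
        Polynomial.aeval_X, IsScalarTower.algebraMap_apply ℂ P K, div_pow, ← pow_mul, pow_add]
      have hcancel : ∀ x y a b : K, y ≠ 0 → x * y * (a * (b / y)) = a * (x * b) := by
        intro x y a b hy
        calc x * y * (a * (b / y)) = a * (x * (y * (b / y))) := by ring
          _ = a * (x * b) := by rw [mul_div_cancel₀ _ hy]
      exact hcancel _ _ _ _ (pow_ne_zero _ hFK)
    rw [h, map_zero φ] at h1
    exact (mul_eq_zero.mp h1).resolve_left (pow_ne_zero _ hFK)
  obtain ⟨c, hc⟩ := (IsAlgClosed.splits r).mem_range_of_isRoot hr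
    (i := algebraMap ℂ K) (x := z) (by rw [Polynomial.IsRoot, Polynomial.eval_map_algebraMap, hz])
  refine ⟨c, hφ ?_⟩
  have hc' : φ (C c) = φ G / φ F ^ q :=
    (IsScalarTower.algebraMap_apply ℂ P K c).symm.trans hc
  rw [map_mul, hc', map_pow, div_mul_cancel₀ _ (pow_ne_zero _ hFK)]

theorem exists_polynomial_of_support {U : P} (hU : ∀ s ∈ U.support, s 1 = 0) :
    ∃ r : Polynomial ℂ, U = Polynomial.aeval (X 0) r := by
  refine ⟨aeval ![Polynomial.X, 0] U, ?_⟩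
  rw [aeval_cons_eq_sum, map_sum]
  conv_lhs => rw [U.as_sum]
  refine Finset.sum_congr rfl fun s hs => ?_
  rw [monomial_eq]
  simp [Finsupp.prod_fintype, Fin.prod_univ_two, hU s hs, algebraMap_eq]

theorem bound_of_not_dvd {m n k w δ : ℕ} (hm : 0 < m) (hmn : m ≤ n) (hdvd : ¬ m ∣ n) (hk : 0 < k)
    (hw : n * (m / m.gcd n) * k ≤ w) (hδ : w + 2 * k ≤ δ + k * (m + n)) :
    n ≤ 3 * (δ - 1) := by
  have hd : 0 < m.gcd n := Nat.gcd_pos_of_pos_left n hm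
  obtain ⟨a, b, -, hma, hnb⟩ := Nat.exists_coprime m n
  generalize m.gcd n = d at *
  subst hma hnb
  rw [Nat.mul_div_cancel _ hd] at hw
  have ha : 2 ≤ a := by
    by_contra! h
    interval_cases a
    · simp at hm
    · exact hdvd ⟨b, by ring⟩
  have hab : a < b := by
    refine lt_of_le_of_ne (Nat.le_of_mul_le_mul_right hmn hd) ?_
    rintro rfl
    exact hdvd dvd_rfl
  have key : 3 * a + 4 * b ≤ 3 * (a * b) := by nlinarith
  have key' : 3 * (a * d) + 4 * (b * d) ≤ 3 * (b * d * a) := by nlinarith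
  have h1 : k * (b * d * a + 2) ≤ δ + k * (a * d + b * d) := by nlinarith
  obtain ⟨e, he⟩ : ∃ e, b * d * a = a * d + b * d + e := Nat.exists_eq_add_of_le (by omega)
  have h2 : k * (e + 2) ≤ δ := by rw [he] at h1; nlinarith
  have h3 : e + 2 ≤ δ := (Nat.le_mul_of_pos_left _ hk).trans h2
  omega

/-- A pair of generators of a polynomial subalgebra that cannot be shortened by an elementary
transformation: a polynomial in them that involves the second one has large degree. -/
theorem dichotomy_of_reduced {ψ : P →ₐ[ℂ] P} (hψ : Function.Injective ψ)
    (hle : (ψ (X 0)).totalDegree ≤ (ψ (X 1)).totalDegree)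
    (hred : ∀ (c : ℂ) (q : ℕ),
      (ψ (X 1)).totalDegree ≤ (ψ (X 1) - C c * ψ (X 0) ^ q).totalDegree) (U : P) :
    (∃ r : Polynomial ℂ, U = Polynomial.aeval (X 0) r) ∨
      (ψ (X 1)).totalDegree ≤ max (ψ U).totalDegree (3 * ((ψ U).totalDegree - 1)) := by
  classical
  by_cases hU : ∀ s ∈ U.support, s 1 = 0
  · exact Or.inl (exists_polynomial_of_support hU)
  right
  push Not at hU
  obtain ⟨s₁, hs₁, hs₁0⟩ := hU
  have hJ := jacDet_ne_zero_of_injective hψ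
  obtain ⟨hm, hn⟩ := totalDegree_pos_of_jacDet_ne_zero hJ
  set f := ψ (X 0) with hf
  set g := ψ (X 1) with hg
  set m := f.totalDegree with hm'
  set n := g.totalDegree with hn'
  have hψU : ψ U = aeval ![f, g] U := by
    have : aeval ![f, g] = ψ := by ext i; fin_cases i <;> simp [hf, hg]
    rw [this]
  have hf0 : f ≠ 0 := by rintro h; simp [hm', h] at hm
  have hg0 : g ≠ 0 := by rintro h; simp [hn', h] at hn
  obtain ⟨s₀, hs₀, hmax⟩ := U.support.exists_max_image (fun s => m * s 0 + n * s 1) ⟨s₁, hs₁⟩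
  set w := m * s₀ 0 + n * s₀ 1 with hw
  let A : P := weightedHomogeneousComponent ![m, n] w U
  have hcoeff (s : Fin 2 →₀ ℕ) : coeff s A = if m * s 0 + n * s 1 = w then coeff s U else 0 := by
    rw [coeff_weightedHomogeneousComponent]
    simp [Finsupp.weight_apply, Finsupp.sum_fintype, Fin.sum_univ_two, mul_comm]
  have hA : ∀ s ∈ A.support, m * s 0 + n * s 1 = w := by
    intro s hs
    by_contra h
    exact mem_support_iff.mp hs (by rw [hcoeff, if_neg h])
  have hA0 : A ≠ 0 := by
    intro h
    have := hcoeff s₀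
    rw [h, if_pos rfl, coeff_zero] at this
    exact mem_support_iff.mp hs₀ this.symm
  have hB : ∀ s ∈ (U - A).support, m * s 0 + n * s 1 < w := by
    intro s hs
    rw [mem_support_iff, coeff_sub, hcoeff] at hs
    split_ifs at hs with h
    · exact absurd (sub_self _) hs
    · rw [sub_zero] at hs
      exact lt_of_le_of_ne (hmax s (mem_support_iff.mpr hs)) h
  have hnw : n ≤ w := by
    have h1 : m * s₁ 0 + n * s₁ 1 ≤ w := hmax s₁ hs₁
    have h2 : n * 1 ≤ n * s₁ 1 := Nat.mul_le_mul_left n (Nat.one_le_iff_ne_zero.mpr hs₁0)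
    omega
  have hF0 := homogeneousComponent_totalDegree_ne_zero hf0
  have hG0 := homogeneousComponent_totalDegree_ne_zero hg0
  obtain ⟨-, hdeg⟩ := weight_le_totalDegree_aeval hJ _ w A (U - A) hA hB hA0 rfl
  have hmul := mul_rootMultiplicity_slice_le hm hA hF0 hG0 hA0
  rw [add_sub_cancel, ← hψU] at hdeg
  set k := (slice (homogeneousComponent m f) A).rootMultiplicity (homogeneousComponent n g) with hk
  rcases Nat.eq_zero_or_pos k with hk0 | hkpos
  · rw [hk0] at hdeg
    exact le_max_of_le_left (by omega)
  refine le_max_of_le_right (bound_of_not_dvd hm hle ?_ hkpos hmul hdeg)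
  rintro ⟨q, hq⟩
  have hroot := (Polynomial.rootMultiplicity_pos (slice_ne_zero hm hA hF0 hA0)).mp hkpos
  rw [Polynomial.IsRoot, eval_slice] at hroot
  rw [hq] at hA
  obtain ⟨c, hc⟩ := exists_eq_C_mul_pow hF0 hm hA0 hA hroot
  refine (hred c q).not_gt (totalDegree_lt_of_homogeneousComponent_eq_zero hn ?_ ?_)
  · refine (totalDegree_sub _ _).trans (max_le le_rfl ((totalDegree_mul _ _).trans ?_))
    rw [totalDegree_C, zero_add]
    exact (totalDegree_pow _ _).trans (by rw [mul_comm, hq])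
  · rw [map_sub, homogeneousComponent_C_mul]
    conv_lhs => rw [hq]
    rw [homogeneousComponent_mul_pow le_rfl, ← hq, hc, sub_self]

/-- The elementary automorphism `x ↦ x`, `y ↦ y - r(x)`. -/
noncomputable def elementaryEquiv (r : Polynomial ℂ) : P ≃ₐ[ℂ] P :=
  AlgEquiv.ofAlgHom (aeval ![X 0, X 1 - Polynomial.aeval (X 0) r])
    (aeval ![X 0, X 1 + Polynomial.aeval (X 0) r])
    (by ext i; fin_cases i <;> simp [← Polynomial.aeval_algHom_apply])
    (by ext i; fin_cases i <;> simp [← Polynomial.aeval_algHom_apply])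

theorem exists_reduced (ψ : P →ₐ[ℂ] P) : ∃ α : P ≃ₐ[ℂ] P,
    (ψ (α (X 0))).totalDegree ≤ (ψ (α (X 1))).totalDegree ∧ ∀ (c : ℂ) (q : ℕ),
      (ψ (α (X 1))).totalDegree ≤ (ψ (α (X 1)) - C c * ψ (α (X 0)) ^ q).totalDegree := by
  let μ : (P ≃ₐ[ℂ] P) → ℕ := fun α => (ψ (α (X 0))).totalDegree + (ψ (α (X 1))).totalDegree
  obtain ⟨α, hα⟩ : ∃ α, ∀ β, μ α ≤ μ β :=
    ⟨Function.argmin μ, fun β => Function.argmin_le μ β⟩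
  wlog hle : (ψ (α (X 0))).totalDegree ≤ (ψ (α (X 1))).totalDegree generalizing α
  · refine this ((renameEquiv ℂ (Equiv.swap (0 : Fin 2) 1)).trans α) (fun β => ?_) ?_
    · refine le_trans (le_of_eq ?_) (hα β)
      simp [μ, add_comm]
    · simpa using le_of_not_ge hle
  refine ⟨α, hle, fun c q => ?_⟩
  have := hα ((elementaryEquiv (Polynomial.C c * Polynomial.X ^ q)).trans α)
  have hC : α (C c) = C c := α.commutes c
  have hC' : ψ (C c) = C c := ψ.commutes c
  simpa [μ, elementaryEquiv, algebraMap_eq, hC, hC'] using this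

theorem dichotomy {ψ : P →ₐ[ℂ] P} (hψ : Function.Injective ψ) (u : P) : ∃ α : P ≃ₐ[ℂ] P,
    (∃ r : Polynomial ℂ, u = Polynomial.aeval (α (X 0)) r) ∨ ∀ i,
      (ψ (α (X i))).totalDegree ≤ max (ψ u).totalDegree (3 * ((ψ u).totalDegree - 1)) := by
  obtain ⟨α, hle, hred⟩ := exists_reduced ψ
  refine ⟨α, ?_⟩
  have hαu : ψ.comp (α : P →ₐ[ℂ] P) (α.symm u) = ψ u := congrArg ψ (α.apply_symm_apply u)
  have h := dichotomy_of_reduced (ψ := ψ.comp (α : P →ₐ[ℂ] P)) (hψ.comp α.injective) hle hred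
    (α.symm u)
  rw [hαu] at h
  refine h.imp ?_ fun h i => ?_
  · rintro ⟨r, hr⟩
    refine ⟨r, ?_⟩
    rw [Polynomial.aeval_algHom_apply, ← hr, AlgEquiv.apply_symm_apply]
  · fin_cases i
    · exact hle.trans h
    · exact h

theorem injective_of_jacDet_ne_zero {φ : P →ₐ[ℂ] P}
    (hφ : jacDet (φ (X 0)) (φ (X 1)) ≠ 0) : Function.Injective φ := by
  refine (injective_iff_map_eq_zero φ).mpr fun F => ?_
  induction hn : F.totalDegree using Nat.strong_induction_on generalizing F with
  | _ n ih =>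
    subst hn
    intro hF
    have h0 : φ (pderiv 0 F) = 0 := by
      have h := jacDet_algHom_apply φ F (X 1)
      rw [hF, show jacDet 0 (φ (X 1)) = 0 by simp [jacDet], eq_comm] at h
      simpa [jacDet] using (mul_eq_zero.mp h).resolve_right hφ
    have h1 : φ (pderiv 1 F) = 0 := by
      have h := jacDet_algHom_apply φ (X 0) F
      rw [hF, show jacDet (φ (X 0)) 0 = 0 by simp [jacDet], eq_comm] at h
      simpa [jacDet] using (mul_eq_zero.mp h).resolve_right hφ
    have key : ∀ i, φ (pderiv i F) = 0 → pderiv i F = 0 := by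
      intro i hi
      by_contra hne
      have := totalDegree_pos_of_pderiv_ne_zero hne
      exact hne (ih _ (by have := totalDegree_pderiv_le i F; omega) _ rfl hi)
    obtain ⟨c, rfl⟩ := eq_C_of_pderiv_eq_zero (f := F) fun i => by
      fin_cases i
      · exact key 0 h0
      · exact key 1 h1
    rw [← algebraMap_eq, AlgHom.commutes, algebraMap_eq] at hF
    exact hF

theorem isUnit_jacDet_comp {φ ψ : P →ₐ[ℂ] P} (hφ : IsUnit (jacDet (φ (X 0)) (φ (X 1))))
    (hψ : IsUnit (jacDet (ψ (X 0)) (ψ (X 1)))) :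
    IsUnit (jacDet (ψ (φ (X 0))) (ψ (φ (X 1)))) := by
  rw [jacDet_algHom_apply]
  exact (hφ.map ψ).mul hψ

theorem isUnit_jacDet_algEquiv (α : P ≃ₐ[ℂ] P) : IsUnit (jacDet (α (X 0)) (α (X 1))) := by
  have h := jacDet_algHom_apply (α : P →ₐ[ℂ] P) (α.symm (X 0)) (α.symm (X 1))
  simp only [AlgEquiv.coe_toAlgHom, AlgEquiv.apply_symm_apply] at h
  refine IsUnit.of_mul_eq_one_right _ (h.symm.trans ?_)
  simp [jacDet]

theorem surjective_of_forall_mem_range {θ : P →ₐ[ℂ] P} (α : P ≃ₐ[ℂ] P)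
    (h : ∀ i, ∃ w, θ w = α (X i)) : Function.Surjective θ := by
  choose w hw using h
  have hc : θ.comp (aeval w) = (α : P →ₐ[ℂ] P) := by ext i; simp [hw]
  exact fun v => ⟨aeval w (α.symm v), by simpa using DFunLike.congr_fun hc (α.symm v)⟩

theorem surjective_of_apply_X_zero {φ : P →ₐ[ℂ] P} (h0 : φ (X 0) = X 0)
    (hφ : IsUnit (jacDet (φ (X 0)) (φ (X 1)))) : Function.Surjective φ := by
  obtain ⟨c, hc, hJ⟩ := isUnit_iff_eq_C_of_isReduced.mp hφ
  have hJ' : pderiv 1 (φ (X 1)) = C c := by simpa [h0, jacDet] using hJ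
  obtain ⟨r, hr⟩ := exists_polynomial_of_support (U := φ (X 1) - C c * X 1) (by
    intro s hs
    by_contra hs1
    have hle : Finsupp.single 1 1 ≤ s := by simpa [Nat.one_le_iff_ne_zero] using hs1
    have h : pderiv 1 (φ (X 1) - C c * X 1) = 0 := by simp [hJ']
    have h2 := congrArg (coeff (s - Finsupp.single 1 1)) h
    rw [coeff_pderiv, tsub_add_cancel_of_le hle, coeff_zero] at h2
    exact (mul_ne_zero (mem_support_iff.mp hs) (Nat.cast_add_one_ne_zero _)) h2)
  refine surjective_of_forall_mem_range AlgEquiv.refl fun i => ?_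
  fin_cases i
  · exact ⟨X 0, h0⟩
  · refine ⟨C c⁻¹ * (X 1 - Polynomial.aeval (X 0) r), ?_⟩
    have hC : φ (C c⁻¹) = C c⁻¹ := φ.commutes _
    rw [map_mul, map_sub, ← Polynomial.aeval_algHom_apply, h0, ← hr, hC, sub_sub_cancel,
      ← mul_assoc, ← C_mul, inv_mul_cancel₀ hc.ne_zero, C_1, one_mul]
    rfl

theorem surjective_of_apply_coordinate {φ : P →ₐ[ℂ] P}
    (hφ : IsUnit (jacDet (φ (X 0)) (φ (X 1)))) (α γ : P ≃ₐ[ℂ] P)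
    (h : φ (α (X 0)) = γ (X 0)) : Function.Surjective φ := by
  let Φ : P →ₐ[ℂ] P := (γ.symm : P →ₐ[ℂ] P).comp (φ.comp α)
  have hΦ : Function.Surjective Φ := by
    refine surjective_of_apply_X_zero ?_ ?_
    · exact (congrArg γ.symm h).trans (γ.symm_apply_apply _)
    · exact isUnit_jacDet_comp (φ := φ.comp (α : P →ₐ[ℂ] P)) (ψ := (γ.symm : P →ₐ[ℂ] P))
        (isUnit_jacDet_comp (φ := (α : P →ₐ[ℂ] P)) (isUnit_jacDet_algEquiv α) hφ)
        (isUnit_jacDet_algEquiv γ.symm)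
  intro v
  obtain ⟨w, hw⟩ := hΦ (γ.symm v)
  exact ⟨α w, γ.symm.injective hw⟩

theorem eq_of_totalDegree_le_one {v : P} (hv : v.totalDegree ≤ 1) :
    ∃ a b c : ℂ, v = C a * X 0 + C b * X 1 + C c := by
  refine ⟨coeff (Finsupp.single 0 1) v, coeff (Finsupp.single 1 1) v, coeff 0 v, ?_⟩
  have hsum : ∀ s ∈ v.support, s 0 + s 1 ≤ 1 := fun s hs => by
    have := (le_totalDegree hs).trans hv
    rwa [Finsupp.sum_fintype _ _ (fun _ => rfl), Fin.sum_univ_two] at this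
  ext s
  simp only [coeff_add, coeff_C_mul, coeff_X, coeff_C]
  by_cases hs : s 0 + s 1 ≤ 1
  · have : s = 0 ∨ s = Finsupp.single 0 1 ∨ s = Finsupp.single 1 1 := by
      rcases Nat.eq_zero_or_pos (s 0) with h | h <;> rcases Nat.eq_zero_or_pos (s 1) with h' | h'
      · left; ext i; fin_cases i <;> simp [h, h']
      · right; right; ext i; fin_cases i <;> simp <;> omega
      · right; left; ext i; fin_cases i <;> simp <;> omega
      · omega
    rcases this with rfl | rfl | rfl <;> simp [Finsupp.single_eq_single_iff, eq_comm]
  · have h0 : coeff s v = 0 := notMem_support_iff.mp fun h => hs (hsum s h)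
    have h1 : Finsupp.single 0 1 ≠ s := by rintro rfl; simp at hs
    have h2 : Finsupp.single 1 1 ≠ s := by rintro rfl; simp at hs
    have h3 : 0 ≠ s := by rintro rfl; simp at hs
    simp [h0, h1, h2, h3]

theorem exists_algEquiv_of_totalDegree_eq_one {z : P} (hz : z.totalDegree = 1) :
    ∃ γ : P ≃ₐ[ℂ] P, γ (X 0) = z := by
  obtain ⟨a, b, c, rfl⟩ := eq_of_totalDegree_le_one hz.le
  by_cases ha : a = 0
  · subst ha
    have hb : b ≠ 0 := by rintro rfl; simp at hz
    have hb' : (C b * C b⁻¹ : P) = 1 := by rw [← C_mul, mul_inv_cancel₀ hb, C_1]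
    refine ⟨AlgEquiv.ofAlgHom (aeval ![C 0 * X 0 + C b * X 1 + C c, X 0])
      (aeval ![X 1, C b⁻¹ * (X 0 - C c)]) ?_ ?_, by simp⟩
    · ext i : 1
      fin_cases i
      · simp
      · simp [algebraMap_eq]; linear_combination (X 1) * hb'
    · ext i : 1
      fin_cases i
      · simp [algebraMap_eq]; linear_combination (X 0 - C c) * hb'
      · simp
  · have ha' : (C a * C a⁻¹ : P) = 1 := by rw [← C_mul, mul_inv_cancel₀ ha, C_1]
    refine ⟨AlgEquiv.ofAlgHom (aeval ![C a * X 0 + C b * X 1 + C c, X 1])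
      (aeval ![C a⁻¹ * (X 0 - C b * X 1 - C c), X 1]) ?_ ?_, by simp⟩
    · ext i : 1
      fin_cases i
      · simp [algebraMap_eq]; linear_combination (X 0) * ha'
      · simp
    · ext i : 1
      fin_cases i
      · simp [algebraMap_eq]; linear_combination (X 0 - C b * X 1 - C c) * ha'
      · simp

theorem totalDegree_polynomial_aeval (z : P) (g : Polynomial ℂ) :
    (Polynomial.aeval z g).totalDegree = g.natDegree * z.totalDegree := by
  rcases Nat.eq_zero_or_pos z.totalDegree with hz | hz
  · rw [hz, mul_zero]
    obtain ⟨c, rfl⟩ : ∃ c, z = C c := ⟨_, totalDegree_eq_zero_iff_eq_C.mp hz⟩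
    rw [← algebraMap_eq, Polynomial.aeval_algebraMap_apply, algebraMap_eq, totalDegree_C]
  by_cases hg : 0 < g.degree
  · have hne : ∀ q : Polynomial ℂ, 0 < q.degree →
        (Polynomial.aeval z q).totalDegree = q.natDegree * z.totalDegree →
        0 < (Polynomial.aeval z q).totalDegree := fun q hq h =>
      h ▸ Nat.mul_pos (Polynomial.natDegree_pos_iff_degree_pos.mpr hq) hz
    have hz0 : z ≠ 0 := by rintro rfl; simp at hz
    refine Polynomial.degree_pos_induction_on g hg ?_ ?_ ?_
    · intro a ha
      rw [map_mul, Polynomial.aeval_C, Polynomial.aeval_X, Polynomial.natDegree_C_mul_X _ ha,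
        algebraMap_eq, totalDegree_mul_of_isDomain (C_ne_zero.mpr ha) hz0, totalDegree_C]
      ring
    · intro q hq h
      have h0 : Polynomial.aeval z q ≠ 0 := by
        intro h0
        have := hne q hq h
        simp [h0] at this
      have hq0 : q ≠ 0 := by rintro rfl; simp at hq
      rw [map_mul, Polynomial.aeval_X, totalDegree_mul_of_isDomain h0 hz0, h,
        Polynomial.natDegree_mul_X hq0]
      ring
    · intro q a hq h
      rw [map_add, Polynomial.aeval_C, Polynomial.natDegree_add_C, ← h, algebraMap_eq]
      exact totalDegree_add_eq_left_of_totalDegree_lt (by rw [totalDegree_C]; exact hne q hq h)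
  · rw [Polynomial.eq_C_of_degree_le_zero (not_lt.mp hg)]
    simp [algebraMap_eq]

theorem surjective_of_forall_totalDegree_le {θ : P →ₐ[ℂ] P} (hθ : Function.Injective θ) (D : ℕ)
    (h : ∀ n : ℕ, ∃ α : P ≃ₐ[ℂ] P, ∀ i, ((θ ^ n) (α (X i))).totalDegree ≤ D) :
    Function.Surjective θ := by
  let V : ℕ → Submodule ℂ P := fun n =>
    restrictTotalDegree (Fin 2) ℂ D ⊓ LinearMap.range (θ ^ n).toLinearMap
  have hfin : ∀ n, Module.Finite ℂ (V n) := fun n =>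
    Submodule.finiteDimensional_inf_left _ _
  obtain ⟨n, hn⟩ : ∃ n, ∀ m, Module.finrank ℂ (V n) ≤ Module.finrank ℂ (V m) :=
    ⟨_, fun m => Function.argmin_le (fun n => Module.finrank ℂ (V n)) m⟩
  have hle : V (n + 1) ≤ V n := by
    refine inf_le_inf_left _ ?_
    rintro _ ⟨w, rfl⟩
    exact ⟨θ w, by simp [pow_succ]⟩
  have hV : V (n + 1) = V n := Submodule.eq_of_le_of_finrank_le hle (hn _)
  obtain ⟨α, hα⟩ := h n
  refine surjective_of_forall_mem_range α fun i => ?_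
  have hmem : (θ ^ n) (α (X i)) ∈ V n :=
    ⟨(mem_restrictTotalDegree _ _ _).mpr (hα i), α (X i), rfl⟩
  rw [← hV] at hmem
  obtain ⟨-, w, hw⟩ := hmem
  have hinj : Function.Injective (θ ^ n) := by
    rw [AlgHom.coe_pow]; exact hθ.iterate n
  refine ⟨w, hinj ?_⟩
  rw [← hw, pow_succ]
  rfl

theorem surjective_of_totalDegree_le_one {θ : P →ₐ[ℂ] P} (hθ : Function.Injective θ)
    (h : ∀ i, (θ (X i)).totalDegree ≤ 1) : Function.Surjective θ := by
  have hdeg : ∀ v : P, v.totalDegree ≤ 1 → (θ v).totalDegree ≤ 1 := by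
    intro v hv
    obtain ⟨a, b, c, rfl⟩ := eq_of_totalDegree_le_one hv
    have hC : ∀ a, θ (C a) = C a := θ.commutes
    simp only [map_add, map_mul, hC]
    refine (totalDegree_add _ _).trans (max_le ((totalDegree_add _ _).trans (max_le ?_ ?_)) ?_)
    · exact (totalDegree_mul _ _).trans (by simpa using h 0)
    · exact (totalDegree_mul _ _).trans (by simpa using h 1)
    · simp
  refine surjective_of_forall_totalDegree_le hθ 1 fun n => ⟨AlgEquiv.refl, fun i => ?_⟩
  rw [AlgHom.coe_pow]
  induction n with
  | zero => simp
  | succ n ih => rw [Function.iterate_succ_apply']; exact hdeg _ ih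

/-- A polynomial sent to a polynomial of degree one by an injective endomorphism is a
coordinate. -/
theorem exists_algEquiv_of_totalDegree_apply_eq_one {ψ : P →ₐ[ℂ] P} (hψ : Function.Injective ψ)
    {u : P} (hu : (ψ u).totalDegree = 1) : ∃ γ : P ≃ₐ[ℂ] P, γ (X 0) = u := by
  obtain ⟨β, ⟨r, hr⟩ | h⟩ := dichotomy hψ u
  · rw [hr, ← Polynomial.aeval_algHom_apply, totalDegree_polynomial_aeval] at hu
    obtain ⟨γ, hγ⟩ := exists_algEquiv_of_totalDegree_eq_one
      (z := Polynomial.aeval (X 0) r) (by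
        rw [totalDegree_polynomial_aeval, totalDegree_X, Nat.eq_one_of_mul_eq_one_right hu])
    refine ⟨γ.trans β, ?_⟩
    rw [hr, Polynomial.aeval_algHom_apply, ← hγ]
    rfl
  · have hinj : Function.Injective (ψ.comp (β : P →ₐ[ℂ] P)) := hψ.comp β.injective
    have hsurj : Function.Surjective (ψ.comp (β : P →ₐ[ℂ] P)) :=
      surjective_of_totalDegree_le_one hinj fun i => by simpa [hu] using h i
    have hsurj' : Function.Surjective ψ := Function.Surjective.of_comp (g := β) hsurj
    obtain ⟨γ, hγ⟩ := exists_algEquiv_of_totalDegree_eq_one hu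
    refine ⟨γ.trans (AlgEquiv.ofBijective ψ ⟨hψ, hsurj'⟩).symm, ?_⟩
    rw [AlgEquiv.trans_apply, hγ, AlgEquiv.symm_apply_eq]
    rfl

/-- Let `φ` be a `ℂ`-algebra endomorphism of `ℂ[x,y]` with invertible Jacobian
matrix (its Jacobian determinant is a nonzero constant).  If there exist a
non-constant polynomial `p` and an injective `ℂ`-algebra endomorphism `ψ` such
that `ψ(φ(p)) = p`, then `φ` is an automorphism of `ℂ[x,y]`. -/
theorem jacobian_invertible_on_one_polynomial (φ : P →ₐ[ℂ] P)
    (hjac : ∃ c : ℂ, c ≠ 0 ∧ jacDet (φ (X 0)) (φ (X 1)) = C c)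
    (p : P) (hp : p.totalDegree ≠ 0)
    (ψ : P →ₐ[ℂ] P) (hψ : Function.Injective ψ)
    (hfix : ψ (φ p) = p) :
    Function.Bijective φ := by
  obtain ⟨c, hc, hJ⟩ := hjac
  have hunit : IsUnit (jacDet (φ (X 0)) (φ (X 1))) := by
    rw [hJ]; exact (isUnit_iff_ne_zero.mpr hc).map C
  have hinj : Function.Injective φ := injective_of_jacDet_ne_zero hunit.ne_zero
  refine ⟨hinj, ?_⟩
  let θ : P →ₐ[ℂ] P := ψ.comp φ
  have hθ : Function.Injective θ := hψ.comp hinj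
  have hθp : ∀ n : ℕ, (θ ^ n) p = p := fun n => by
    rw [AlgHom.coe_pow]; exact Function.iterate_fixed hfix n
  have hθn : ∀ n : ℕ, Function.Injective (θ ^ n) := fun n => by
    rw [AlgHom.coe_pow]; exact hθ.iterate n
  by_cases hall : ∀ n : ℕ, ∃ α : P ≃ₐ[ℂ] P, ∀ i,
      ((θ ^ n) (α (X i))).totalDegree ≤ max p.totalDegree (3 * (p.totalDegree - 1))
  · intro v
    obtain ⟨w, hw⟩ := surjective_of_forall_totalDegree_le hθ _ hall (ψ v)
    exact ⟨w, hψ hw⟩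
  push Not at hall
  obtain ⟨n, hn⟩ := hall
  obtain ⟨α, ⟨g, hg⟩ | h⟩ := dichotomy (hθn n) p
  · have hψα : Function.Injective ((α.symm : P →ₐ[ℂ] P).comp ψ) := α.symm.injective.comp hψ
    have hgX : Polynomial.aeval (X 0) g = α.symm p := by
      rw [hg, ← Polynomial.aeval_algHom_apply, AlgEquiv.symm_apply_apply]
    have hgz : Polynomial.aeval (α.symm (ψ (φ (α (X 0))))) g = α.symm p := by
      rw [Polynomial.aeval_algHom_apply, Polynomial.aeval_algHom_apply,
        Polynomial.aeval_algHom_apply, ← hg, hfix]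
    have hdeg := congrArg totalDegree (hgz.trans hgX.symm)
    rw [totalDegree_polynomial_aeval, totalDegree_polynomial_aeval, totalDegree_X] at hdeg
    have hg0 : 0 < g.natDegree := by
      rw [hg, totalDegree_polynomial_aeval] at hp
      exact Nat.pos_of_ne_zero (left_ne_zero_of_mul hp)
    obtain ⟨γ, hγ⟩ := exists_algEquiv_of_totalDegree_apply_eq_one hψα (u := φ (α (X 0)))
      (Nat.eq_of_mul_eq_mul_left hg0 hdeg)
    exact surjective_of_apply_coordinate hunit α γ hγ.symm
  · rw [hθp] at h
    obtain ⟨i, hi⟩ := hn α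
    exact absurd (h i) hi.not_ge
end

section
/- If φ is a ℂ-algebra endomorphism of ℂ[x,y] with invertible Jacobian matrix which is not an automorphism (i.e., a counterexample to the Jacobian conjecture for ℂ[x,y]), then φ(x) is a test polynomial. -/
open MvPolynomial

/-- `ℂ[x,y]` as multivariate polynomials in two variables. -/
local notation "P" => MvPolynomial (Fin 2) ℂ

/-- A test polynomial: every `ℂ`-algebra endomorphism fixing it is an automorphism. -/
def IsTestPolynomial (p : P) : Prop :=
  ∀ φ : P →ₐ[ℂ] P, φ p = p → Function.Bijective φ

open scoped Polynomial

/-- The local order of the Wronskian-like combination `l f' g - n f g'` at a root of `f`. -/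
lemma rootMultiplicity_wronskian (f g e : ℂ[X]) (n l : ℕ) (hf : f ≠ 0) (hg : g ≠ 0) (he0 : e ≠ 0)
    (he : (l : ℂ[X]) * Polynomial.derivative f * g - (n : ℂ[X]) * f * Polynomial.derivative g = e)
    (a : ℂ) :
    f.rootMultiplicity a + g.rootMultiplicity a ≤ e.rootMultiplicity a + 1 ∧
    (l * f.rootMultiplicity a ≠ n * g.rootMultiplicity a →
      f.rootMultiplicity a + g.rootMultiplicity a = e.rootMultiplicity a + 1) ∧
    (l * f.rootMultiplicity a = n * g.rootMultiplicity a →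
      f.rootMultiplicity a + g.rootMultiplicity a ≤ e.rootMultiplicity a) := by
  obtain ⟨f₁, hf₁, hfd⟩ := f.exists_eq_pow_rootMultiplicity_mul_and_not_dvd hf a
  obtain ⟨g₁, hg₁, hgd⟩ := g.exists_eq_pow_rootMultiplicity_mul_and_not_dvd hg a
  set m := f.rootMultiplicity a
  set k := g.rootMultiplicity a
  set t : ℂ[X] := Polynomial.X - Polynomial.C a with ht
  have ht0 : t ≠ 0 := Polynomial.X_sub_C_ne_zero a
  have hpow (j : ℕ) : t * Polynomial.derivative (t ^ j) = (j : ℂ[X]) * t ^ j := by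
    rcases j with _ | j
    · simp
    · rw [Polynomial.derivative_pow]
      simp [ht]
      ring
  have hfac : t * e = t ^ (m + k) * (((l : ℂ[X]) * m - n * k) * (f₁ * g₁) +
      t * (l * Polynomial.derivative f₁ * g₁ - n * f₁ * Polynomial.derivative g₁)) := by
    rw [← he, hf₁, hg₁]
    simp only [Polynomial.derivative_mul]
    have h1 := hpow m
    have h2 := hpow k
    rw [pow_add]
    linear_combination (l : ℂ[X]) * f₁ * g₁ * t ^ k * h1 - n * f₁ * g₁ * t ^ m * h2
  have hte : t * e ≠ 0 := mul_ne_zero ht0 he0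
  have hrm : (t * e).rootMultiplicity a = e.rootMultiplicity a + 1 := by
    rw [Polynomial.rootMultiplicity_mul hte, ht, Polynomial.rootMultiplicity_X_sub_C_self, add_comm]
  refine ⟨?_, ?_, ?_⟩
  · rw [← hrm]
    exact (Polynomial.le_rootMultiplicity_iff hte).2 (hfac ▸ Dvd.intro _ rfl)
  · intro hne
    rw [← hrm]
    apply le_antisymm
    · exact (Polynomial.le_rootMultiplicity_iff hte).2 (hfac ▸ Dvd.intro _ rfl)
    · rw [Polynomial.rootMultiplicity_le_iff hte, hfac, pow_succ,
        mul_dvd_mul_iff_left (pow_ne_zero _ ht0)]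
      intro hd
      have hd2 := (dvd_add_left (Dvd.intro _ rfl)).1 hd
      have hc : ((l : ℂ[X]) * m - n * k) = Polynomial.C ((l : ℂ) * m - n * k) := by simp
      rw [hc] at hd2
      have hc0 : ((l : ℂ) * m - n * k) ≠ 0 := by
        rw [sub_ne_zero]
        exact_mod_cast hne
      have hprime : Prime t := Polynomial.prime_X_sub_C a
      rcases hprime.dvd_or_dvd hd2 with h | h
      · have : IsUnit t := isUnit_of_dvd_unit h (Polynomial.isUnit_C.2 hc0.isUnit)
        exact hprime.not_isUnit this
      · rcases hprime.dvd_or_dvd h with h | h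
        · exact hfd h
        · exact hgd h
  · intro heq
    have : m + k + 1 ≤ e.rootMultiplicity a + 1 := by
      rw [← hrm]
      refine (Polynomial.le_rootMultiplicity_iff hte).2 ?_
      have hc : ((l : ℂ[X]) * m - n * k) = 0 := by
        rw [sub_eq_zero]
        exact_mod_cast heq
      rw [hfac, hc, pow_succ]
      refine mul_dvd_mul_left _ ?_
      rw [zero_mul, zero_add]
      exact Dvd.intro _ rfl
    omega

lemma card_roots_of_wronskian (f g e : ℂ[X]) (n l T S w : ℕ) (κ : ℂ) (hT : 0 < T)
    (hκ : κ ≠ 0) (hf : f ≠ 0)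
    (he : (l : ℂ[X]) * Polynomial.derivative f * g - (n : ℂ[X]) * f * Polynomial.derivative g = e)
    (hpow : e ^ T = Polynomial.C κ * f ^ S) (hdeg : T * (n + l) = S * n + T * w) (hw : 0 < w) :
    f.roots.toFinset.card ≤ 1 ∨ f.roots.toFinset.card * n ≤ w * f.natDegree := by
  have hR : Polynomial.C κ * f ^ S ≠ 0 :=
    mul_ne_zero (Polynomial.C_ne_zero.2 hκ) (pow_ne_zero _ hf)
  have he0 : e ≠ 0 := by
    rintro rfl
    rw [zero_pow hT.ne'] at hpow
    exact hR hpow.symm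
  have hg : g ≠ 0 := by
    rintro rfl
    exact he0 (by rw [← he]; simp)
  have hord (a : ℂ) : T * e.rootMultiplicity a = S * f.rootMultiplicity a := by
    have h := congrArg (Polynomial.rootMultiplicity a) hpow
    rw [Polynomial.rootMultiplicity_mul hR, Polynomial.rootMultiplicity_C, zero_add] at h
    have hp (u : ℂ[X]) (j : ℕ) : (u ^ j).rootMultiplicity a = j * u.rootMultiplicity a := by
      rw [← Polynomial.count_roots, ← Polynomial.count_roots, Polynomial.roots_pow,
        Multiset.count_nsmul]
    rwa [hp, hp] at h
  have hdege : T * e.natDegree = S * f.natDegree := by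
    have h := congrArg Polynomial.natDegree hpow
    rwa [Polynomial.natDegree_C_mul hκ, Polynomial.natDegree_pow, Polynomial.natDegree_pow] at h
  have hloc : ∀ a ∈ f.roots.toFinset, T * f.rootMultiplicity a + T * g.rootMultiplicity a =
      S * f.rootMultiplicity a + T := by
    intro a ha
    have hm : 0 < f.rootMultiplicity a := by
      rw [Polynomial.rootMultiplicity_pos hf]
      simpa [hf] using ha
    obtain ⟨-, h2, h3⟩ := rootMultiplicity_wronskian f g e n l hf hg he0 he a
    have ho := hord a
    by_cases hc : l * f.rootMultiplicity a = n * g.rootMultiplicity a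
    · exfalso
      have h := h3 hc
      set m := f.rootMultiplicity a
      set k := g.rootMultiplicity a
      have e1 : n * (T * (m + k)) = n * (S * m) + T * w * m := by
        have := congrArg (· * m) hdeg
        linear_combination this - T * hc
      have e2 : n * (T * (m + k)) ≤ n * (S * m) := by
        rw [← ho]
        gcongr
      have : 0 < T * w * m := by positivity
      omega
    · have h := h2 hc
      rw [← mul_add, h, mul_add, ho, mul_one]
  have hsumf : ∑ a ∈ f.roots.toFinset, f.rootMultiplicity a = f.natDegree := by
    rw [← IsAlgClosed.card_roots_eq_natDegree, ← Multiset.toFinset_sum_count_eq]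
    exact Finset.sum_congr rfl fun a _ => (Polynomial.count_roots f).symm
  have hsumg : ∑ a ∈ f.roots.toFinset, g.rootMultiplicity a ≤ g.natDegree := by
    have h1 : ∑ a ∈ f.roots.toFinset, g.rootMultiplicity a ≤
        ∑ a ∈ f.roots.toFinset ∪ g.roots.toFinset, g.roots.count a := by
      simp only [Polynomial.count_roots]
      exact Finset.sum_le_sum_of_subset Finset.subset_union_left
    rw [Multiset.sum_count_eq_card
      (fun a ha => Finset.mem_union_right _ (Multiset.mem_toFinset.2 ha))] at h1
    exact h1.trans (Polynomial.card_roots' g)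
  have hsum := Finset.sum_congr rfl hloc
  simp only [Finset.sum_add_distrib, ← Finset.mul_sum, Finset.sum_const, smul_eq_mul, hsumf] at hsum
  set d := f.roots.toFinset.card
  by_cases hc : l * f.natDegree = n * g.natDegree
  · right
    have h1 : T * (d * n) ≤ T * (w * f.natDegree) := by
      have e1 : n * (T * f.natDegree + T * g.natDegree) =
          n * (S * f.natDegree) + T * (w * f.natDegree) := by
        linear_combination f.natDegree * hdeg - T * hc
      have e2 : n * (T * f.natDegree + T * g.natDegree) ≥ n * (S * f.natDegree + d * T) := by
        rw [← hsum]
        gcongr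
      nlinarith
    exact Nat.le_of_mul_le_mul_left h1 hT
  · left
    have hcoef : (Polynomial.X * e).coeff (f.natDegree + g.natDegree) =
        ((l : ℂ) * f.natDegree - n * g.natDegree) * (f.leadingCoeff * g.leadingCoeff) := by
      have hX (u : ℂ[X]) : (Polynomial.X * Polynomial.derivative u).natDegree ≤ u.natDegree := by
        rcases Nat.eq_zero_or_pos u.natDegree with h | h
        · rw [Polynomial.derivative_of_natDegree_zero h]; simp
        · refine Polynomial.natDegree_mul_le.trans ?_
          have := Polynomial.natDegree_derivative_lt h.ne'
          rw [Polynomial.natDegree_X]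
          omega
      have hXc (u : ℂ[X]) : (Polynomial.X * Polynomial.derivative u).coeff u.natDegree =
          u.natDegree * u.leadingCoeff := by
        rw [Polynomial.leadingCoeff]
        rcases h : u.natDegree with _ | j
        · simp
        · rw [Polynomial.coeff_X_mul, Polynomial.coeff_derivative]
          push_cast
          ring
      have : Polynomial.X * e = Polynomial.C (l : ℂ) * ((Polynomial.X * Polynomial.derivative f) * g)
          - Polynomial.C (n : ℂ) * (f * (Polynomial.X * Polynomial.derivative g)) := by
        rw [← he]
        simp
        ring
      rw [this, Polynomial.coeff_sub, Polynomial.coeff_C_mul, Polynomial.coeff_C_mul,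
        Polynomial.coeff_mul_add_eq_of_natDegree_le (hX f) le_rfl,
        Polynomial.coeff_mul_add_eq_of_natDegree_le le_rfl (hX g), hXc, hXc,
        Polynomial.coeff_natDegree,
        Polynomial.coeff_natDegree]
      ring
    have hne : (Polynomial.X * e).coeff (f.natDegree + g.natDegree) ≠ 0 := by
      rw [hcoef]
      refine mul_ne_zero (sub_ne_zero.2 (by exact_mod_cast hc)) (mul_ne_zero ?_ ?_) <;> simpa
    have h1 := Polynomial.le_natDegree_of_ne_zero hne
    rw [Polynomial.natDegree_X_mul he0] at h1
    have h2 : T * f.natDegree + T * g.natDegree ≤ S * f.natDegree + T := by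
      rw [← hdege]
      nlinarith
    have h3 : d * T ≤ 1 * T := by
      nlinarith
    exact Nat.le_of_mul_le_mul_right h3 hT

/-- The derivation of `ℂ[X][T]` differentiating the coefficients with respect to `X`. -/
noncomputable def coeffDeriv : Derivation ℂ ℂ[X][X] ℂ[X][X] :=
  PolynomialModule.equivPolynomialSelf.compDer Polynomial.derivative'.mapCoeffs

lemma coeff_coeffDeriv (F : ℂ[X][X]) (i : ℕ) :
    (coeffDeriv F).coeff i = Polynomial.derivative (F.coeff i) := rfl

/-- The derivation `T ∂/∂T` of `ℂ[X][T]`. -/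
noncomputable def eulerDeriv : Derivation ℂ ℂ[X][X] ℂ[X][X] :=
  (Polynomial.X : ℂ[X][X]) • (Polynomial.derivative' (R := ℂ[X])).restrictScalars ℂ

lemma eulerDeriv_apply (F : ℂ[X][X]) :
    eulerDeriv F = Polynomial.X * Polynomial.derivative F := rfl

lemma coeff_eulerDeriv (F : ℂ[X][X]) (i : ℕ) :
    (eulerDeriv F).coeff i = (i : ℂ[X]) * F.coeff i := by
  rw [eulerDeriv_apply]
  rcases i with _ | i
  · simp
  · rw [Polynomial.coeff_X_mul, Polynomial.coeff_derivative]
    push_cast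
    ring

lemma coeffDeriv_C_C (κ : ℂ) : coeffDeriv (Polynomial.C (Polynomial.C κ)) = 0 :=
  coeffDeriv.map_algebraMap κ

lemma eulerDeriv_C_C (κ : ℂ) : eulerDeriv (Polynomial.C (Polynomial.C κ)) = 0 :=
  eulerDeriv.map_algebraMap κ

/-- The bracket `∂_X F · T∂_T G - T∂_T F · ∂_X G`. -/
noncomputable def bracket (F G : ℂ[X][X]) : ℂ[X][X] :=
  coeffDeriv F * eulerDeriv G - eulerDeriv F * coeffDeriv G

lemma natDegree_coeffDeriv_le (F : ℂ[X][X]) : (coeffDeriv F).natDegree ≤ F.natDegree :=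
  Polynomial.natDegree_le_iff_coeff_eq_zero.2 fun i hi => by
    rw [coeff_coeffDeriv, Polynomial.coeff_eq_zero_of_natDegree_lt hi, Polynomial.derivative_zero]

lemma natDegree_eulerDeriv_le (F : ℂ[X][X]) : (eulerDeriv F).natDegree ≤ F.natDegree :=
  Polynomial.natDegree_le_iff_coeff_eq_zero.2 fun i hi => by
    rw [coeff_eulerDeriv, Polynomial.coeff_eq_zero_of_natDegree_lt hi, mul_zero]

lemma natDegree_bracket_le (F G : ℂ[X][X]) :
    (bracket F G).natDegree ≤ F.natDegree + G.natDegree := by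
  refine (Polynomial.natDegree_sub_le _ _).trans (max_le ?_ ?_)
  · exact Polynomial.natDegree_mul_le.trans
      (add_le_add (natDegree_coeffDeriv_le F) (natDegree_eulerDeriv_le G))
  · exact Polynomial.natDegree_mul_le.trans
      (add_le_add (natDegree_eulerDeriv_le F) (natDegree_coeffDeriv_le G))

lemma coeff_bracket (F G : ℂ[X][X]) :
    (bracket F G).coeff (F.natDegree + G.natDegree) =
      (G.natDegree : ℂ[X]) * Polynomial.derivative F.leadingCoeff * G.leadingCoeff -
        (F.natDegree : ℂ[X]) * F.leadingCoeff * Polynomial.derivative G.leadingCoeff := by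
  rw [bracket, Polynomial.coeff_sub,
    Polynomial.coeff_mul_add_eq_of_natDegree_le (natDegree_coeffDeriv_le F)
      (natDegree_eulerDeriv_le G),
    Polynomial.coeff_mul_add_eq_of_natDegree_le (natDegree_eulerDeriv_le F)
      (natDegree_coeffDeriv_le G)]
  simp only [coeff_coeffDeriv, coeff_eulerDeriv, Polynomial.coeff_natDegree]
  ring

lemma bracket_sub_right (F G H : ℂ[X][X]) : bracket F (G - H) = bracket F G - bracket F H := by
  simp only [bracket, map_sub]
  ring

lemma bracket_pow_right (F G : ℂ[X][X]) (n : ℕ) :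
    bracket F (G ^ n) = (n : ℂ[X][X]) * G ^ (n - 1) * bracket F G := by
  simp only [bracket, Derivation.leibniz_pow, smul_eq_mul, nsmul_eq_mul]
  ring

lemma bracket_self_mul_pow (F : ℂ[X][X]) (κ : ℂ) (n : ℕ) :
    bracket F (Polynomial.C (Polynomial.C κ) * F ^ n) = 0 := by
  simp only [bracket, Derivation.leibniz, Derivation.leibniz_pow, coeffDeriv_C_C, eulerDeriv_C_C,
    smul_eq_mul, nsmul_eq_mul]
  ring

/-- Polynomials with vanishing logarithmic Wronskian are multiplicatively dependent. -/
lemma pow_eq_of_wronskian_eq_zero (f g : ℂ[X]) (n l : ℕ) (hf : f ≠ 0) (hg : g ≠ 0)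
    (h : (l : ℂ[X]) * Polynomial.derivative f * g -
      (n : ℂ[X]) * f * Polynomial.derivative g = 0) :
    ∃ κ : ℂ, κ ≠ 0 ∧ g ^ n = Polynomial.C κ * f ^ l := by
  have hfl : f ^ l ≠ 0 := pow_ne_zero _ hf
  have hgn : g ^ n ≠ 0 := pow_ne_zero _ hg
  have hw : Polynomial.wronskian (f ^ l) (g ^ n) = 0 := by
    have hd (u : ℂ[X]) (j : ℕ) : u * Polynomial.derivative (u ^ j) =
        (j : ℂ[X]) * u ^ j * Polynomial.derivative u := by
      rcases j with _ | j
      · simp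
      · rw [Polynomial.derivative_pow_succ]
        simp
        ring
    have : f * g * Polynomial.wronskian (f ^ l) (g ^ n) = 0 := by
      rw [Polynomial.wronskian]
      linear_combination f * f ^ l * hd g n - g * g ^ n * hd f l - f ^ l * g ^ n * h
    simpa [hf, hg] using this
  obtain ⟨d, a, b, hab, ha, hb⟩ : ∃ d a b : ℂ[X], IsCoprime a b ∧ f ^ l = d * a ∧
      g ^ n = d * b := by
    classical
    let _ : GCDMonoid ℂ[X] := EuclideanDomain.gcdMonoid ℂ[X]
    have h0 : GCDMonoid.gcd (f ^ l) (g ^ n) ≠ 0 := gcd_ne_zero_of_right hgn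
    exact ⟨GCDMonoid.gcd (f ^ l) (g ^ n), _, _,
      isCoprime_div_gcd_div_gcd (p := f ^ l) (q := g ^ n) hgn,
      (EuclideanDomain.mul_div_cancel' h0 (gcd_dvd_left _ _)).symm,
      (EuclideanDomain.mul_div_cancel' h0 (gcd_dvd_right _ _)).symm⟩
  have hd0 : d ≠ 0 := by
    intro h
    rw [h, zero_mul] at ha
    exact hfl ha
  have hw' : Polynomial.wronskian a b = 0 := by
    have : d ^ 2 * Polynomial.wronskian a b = 0 := by
      rw [← hw, ha, hb]
      simp only [Polynomial.wronskian, Polynomial.derivative_mul]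
      ring
    simpa [hd0] using this
  obtain ⟨h1, h2⟩ := hab.wronskian_eq_zero_iff.1 hw'
  have ha' := Polynomial.eq_C_of_derivative_eq_zero h1
  have hb' := Polynomial.eq_C_of_derivative_eq_zero h2
  have ha0 : a.coeff 0 ≠ 0 := by
    intro h
    rw [h, Polynomial.C_0] at ha'
    rw [ha', mul_zero] at ha
    exact hfl ha
  have hb0 : b.coeff 0 ≠ 0 := by
    intro h
    rw [h, Polynomial.C_0] at hb'
    rw [hb', mul_zero] at hb
    exact hgn hb
  refine ⟨b.coeff 0 / a.coeff 0, div_ne_zero hb0 ha0, ?_⟩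
  rw [ha, hb, ha', hb']
  simp only [Polynomial.coeff_C_zero]
  rw [mul_left_comm, ← Polynomial.C_mul, div_mul_cancel₀ _ ha0]

lemma exists_bracket_leadingCoeff (F : ℂ[X][X]) (hF : F.leadingCoeff ≠ 0) (w : ℕ) (N : ℕ) :
    ∀ (Z V : ℂ[X][X]) (T S : ℕ) (κ : ℂ), F.natDegree + Z.natDegree = N + (w + V.natDegree) →
    0 < F.natDegree → V ≠ 0 → bracket F Z = Polynomial.X ^ w * V → 0 < T → κ ≠ 0 →
    V.leadingCoeff ^ T = Polynomial.C κ * F.leadingCoeff ^ S →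
    T * V.natDegree = S * F.natDegree →
    ∃ (g e : ℂ[X]) (l T S : ℕ) (κ : ℂ), 0 < T ∧ κ ≠ 0 ∧
      (l : ℂ[X]) * Polynomial.derivative F.leadingCoeff * g -
        (F.natDegree : ℂ[X]) * F.leadingCoeff * Polynomial.derivative g = e ∧
      e ^ T = Polynomial.C κ * F.leadingCoeff ^ S ∧
      T * (F.natDegree + l) = S * F.natDegree + T * w := by
  induction N using Nat.strong_induction_on with
  | _ N ih =>
    intro Z V T S κ hN hn hV hW hT hκ hlead hdeg
    have hWd : (bracket F Z).natDegree = w + V.natDegree := by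
      rw [hW, Polynomial.natDegree_X_pow_mul _ hV, add_comm]
    have hWl : (bracket F Z).leadingCoeff = V.leadingCoeff := by
      rw [hW, Polynomial.leadingCoeff_mul]
      simp
    have hF0 : F ≠ 0 := by simpa using hF
    have hZ : Z ≠ 0 := by
      rintro rfl
      have : bracket F 0 = 0 := by simp [bracket]
      rw [this] at hW
      exact mul_ne_zero (pow_ne_zero _ Polynomial.X_ne_zero) hV hW.symm
    rcases Nat.eq_zero_or_pos N with rfl | hNpos
    · refine ⟨Z.leadingCoeff, V.leadingCoeff, Z.natDegree, T, S, κ, hT, hκ, ?_, hlead, ?_⟩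
      · rw [← coeff_bracket, hN, zero_add, ← hWd, ← hWl, Polynomial.leadingCoeff]
      · rw [hN, zero_add, mul_add, hdeg]
        ring
    · have h0 : (bracket F Z).coeff (F.natDegree + Z.natDegree) = 0 :=
        Polynomial.coeff_eq_zero_of_natDegree_lt (by omega)
      rw [coeff_bracket] at h0
      obtain ⟨μ, hμ, hpow⟩ := pow_eq_of_wronskian_eq_zero _ _ _ _ hF (by simpa using hZ) h0
      set n := F.natDegree with hn'
      set l := Z.natDegree with hl'
      set Z' := Z ^ n - Polynomial.C (Polynomial.C μ) * F ^ l with hZ'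
      set V' := (n : ℂ[X][X]) * Z ^ (n - 1) * V with hV'
      have hnC : (n : ℂ[X][X]) = Polynomial.C (Polynomial.C (n : ℂ)) := by simp
      have hn0 : (n : ℂ) ≠ 0 := by exact_mod_cast hn.ne'
      have hV'0 : V' ≠ 0 := by
        refine mul_ne_zero (mul_ne_zero ?_ (pow_ne_zero _ hZ)) hV
        exact_mod_cast hn.ne'
      have hW' : bracket F Z' = Polynomial.X ^ w * V' := by
        rw [hZ', bracket_sub_right, bracket_pow_right, bracket_self_mul_pow, hW, hV']
        ring
      have hZ'0 : Z' ≠ 0 := by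
        intro h
        rw [h] at hW'
        have : bracket F 0 = 0 := by simp [bracket]
        rw [this] at hW'
        exact mul_ne_zero (pow_ne_zero _ Polynomial.X_ne_zero) hV'0 hW'.symm
      have hZ'le : Z'.natDegree ≤ n * l := by
        refine (Polynomial.natDegree_sub_le _ _).trans (max_le ?_ ?_)
        · exact Polynomial.natDegree_pow_le
        · refine (Polynomial.natDegree_C_mul_le _ _).trans ?_
          rw [mul_comm n l]
          exact Polynomial.natDegree_pow_le
      have hZ'lt : Z'.natDegree < n * l := by
        refine lt_of_le_of_ne hZ'le fun h => ?_
        have hc : Z'.coeff (n * l) = 0 := by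
          rw [hZ', Polynomial.coeff_sub, Polynomial.coeff_C_mul,
            Polynomial.coeff_pow_of_natDegree_le le_rfl]
          rw [mul_comm n l, Polynomial.coeff_pow_of_natDegree_le le_rfl]
          simpa [sub_eq_zero] using hpow
        rw [← h] at hc
        exact hZ'0 (by simpa using hc)
      have hV'd : V'.natDegree = (n - 1) * l + V.natDegree := by
        rw [hV', hnC,
          Polynomial.natDegree_mul (mul_ne_zero (by simpa using hn0) (pow_ne_zero _ hZ)) hV,
          Polynomial.natDegree_C_mul (by simpa using hn0), Polynomial.natDegree_pow]
      obtain ⟨n₁, hn₁⟩ : ∃ n₁, n = n₁ + 1 := ⟨n - 1, by omega⟩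
      have hnl : n * l = (n - 1) * l + l := by
        rw [hn₁]
        simp
        ring
      have hlt : n + Z'.natDegree < N + (w + V'.natDegree) := by
        rw [hV'd]
        omega
      have hge : w + V'.natDegree ≤ n + Z'.natDegree := by
        rw [add_comm w, ← Polynomial.natDegree_X_pow_mul w hV'0, ← hW']
        exact natDegree_bracket_le F Z'
      refine ih (n + Z'.natDegree - (w + V'.natDegree)) (by omega) Z' V' (T * n)
        (S * n + T * (n - 1) * l) ((n : ℂ) ^ (T * n) * μ ^ (T * (n - 1)) * κ ^ n) (by omega) hn
        hV'0 hW' (by positivity) ?_ ?_ ?_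
      · exact mul_ne_zero (mul_ne_zero (pow_ne_zero _ hn0) (pow_ne_zero _ hμ)) (pow_ne_zero _ hκ)
      · have hl1 : V'.leadingCoeff = Polynomial.C (n : ℂ) * Z.leadingCoeff ^ (n - 1)
            * V.leadingCoeff := by
          rw [hV', hnC, Polynomial.leadingCoeff_mul, Polynomial.leadingCoeff_mul,
            Polynomial.leadingCoeff_C, Polynomial.leadingCoeff_pow]
        rw [hl1, mul_pow, mul_pow, pow_mul V.leadingCoeff, hlead, ← pow_mul,
          show (n - 1) * (T * n) = n * (T * (n - 1)) by ring, pow_mul Z.leadingCoeff, hpow]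
        simp only [map_mul, map_pow]
        ring
      · rw [hV'd, mul_add, mul_right_comm T n V.natDegree, hdeg]
        ring

/-- The exponent of the monomial `x ^ a * y ^ b`. -/
noncomputable def expo (a b : ℕ) : Fin 2 →₀ ℕ := Finsupp.single 0 a + Finsupp.single 1 b

@[simp] lemma expo_zero (a b : ℕ) : expo a b 0 = a := by simp [expo]

@[simp] lemma expo_one (a b : ℕ) : expo a b 1 = b := by simp [expo]

lemma expo_eta (m : Fin 2 →₀ ℕ) : expo (m 0) (m 1) = m := by
  ext i
  fin_cases i <;> simp

lemma expo_eq_iff (a b : ℕ) (m : Fin 2 →₀ ℕ) : m = expo a b ↔ m 0 = a ∧ m 1 = b := by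
  constructor
  · rintro rfl
    simp
  · rintro ⟨rfl, rfl⟩
    exact (expo_eta m).symm

/-- The substitution `x ↦ X T ^ w₁`, `y ↦ T ^ w₂`, which separates weighted degrees. -/
noncomputable def weightHom (w₁ w₂ : ℕ) : P →ₐ[ℂ] ℂ[X][X] :=
  aeval ![Polynomial.C Polynomial.X * Polynomial.X ^ w₁, Polynomial.X ^ w₂]

lemma weightHom_X_zero (w₁ w₂ : ℕ) :
    weightHom w₁ w₂ (X 0) = Polynomial.C Polynomial.X * Polynomial.X ^ w₁ := by
  simp [weightHom]

lemma weightHom_X_one (w₁ w₂ : ℕ) : weightHom w₁ w₂ (X 1) = Polynomial.X ^ w₂ := by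
  simp [weightHom]

lemma weightHom_monomial (w₁ w₂ : ℕ) (m : Fin 2 →₀ ℕ) (r : ℂ) :
    weightHom w₁ w₂ (monomial m r) =
      Polynomial.monomial (w₁ * m 0 + w₂ * m 1) (Polynomial.monomial (m 0) r) := by
  rw [weightHom, aeval_monomial, Finsupp.prod_fintype _ _ (by simp)]
  simp only [Fin.prod_univ_two, Matrix.cons_val_zero, Matrix.cons_val_one]
  rw [← Polynomial.C_mul_X_pow_eq_monomial, ← Polynomial.C_mul_X_pow_eq_monomial,
    show algebraMap ℂ ℂ[X][X] r = Polynomial.C (Polynomial.C r) from rfl]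
  simp only [map_mul, map_pow]
  ring

lemma coeff_weightHom (w₁ w₂ : ℕ) (hw₂ : 0 < w₂) (p : P) (a b : ℕ) :
    ((weightHom w₁ w₂ p).coeff (w₁ * a + w₂ * b)).coeff a = coeff (expo a b) p := by
  induction p using MvPolynomial.induction_on' with
  | add p q hp hq => simp [hp, hq]
  | monomial m r =>
    rw [weightHom_monomial, Polynomial.coeff_monomial, coeff_monomial]
    by_cases h : m 0 = a
    · subst h
      simp [expo_eq_iff, hw₂.ne', apply_ite (fun u : ℂ[X] => u.coeff (m 0))]
    · rw [if_neg (fun h' => h ((expo_eq_iff a b m).1 h').1)]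
      split_ifs
      · simp [Polynomial.coeff_monomial, h]
      · simp

lemma coeff_weightHom_eq_zero (w₁ w₂ : ℕ) (hw₂ : 0 < w₂) (p : P) (N a : ℕ)
    (h : ∀ b, w₁ * a + w₂ * b = N →
    coeff (expo a b) p = 0) : ((weightHom w₁ w₂ p).coeff N).coeff a = 0 := by
  by_cases hb : ∃ b, w₁ * a + w₂ * b = N
  · obtain ⟨b, rfl⟩ := hb
    rw [coeff_weightHom _ _ hw₂, h b rfl]
  · clear h
    push Not at hb
    induction p using MvPolynomial.induction_on' with
    | add p q hp hq => simp [hp, hq]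
    | monomial m r =>
      rw [weightHom_monomial, Polynomial.coeff_monomial]
      split_ifs with h
      · rw [Polynomial.coeff_monomial, if_neg]
        rintro rfl
        exact hb _ h
      · simp

lemma exists_of_coeff_weightHom_ne_zero {w₁ w₂ : ℕ} (hw₂ : 0 < w₂) {p : P} {N a : ℕ}
    (h : ((weightHom w₁ w₂ p).coeff N).coeff a ≠ 0) :
    ∃ b, w₁ * a + w₂ * b = N ∧ coeff (expo a b) p ≠ 0 := by
  by_contra! hb
  exact h (coeff_weightHom_eq_zero _ _ hw₂ _ _ _ hb)

lemma natDegree_weightHom_le_iff {w₁ w₂ : ℕ} (hw₂ : 0 < w₂) {p : P} {N : ℕ} :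
    (weightHom w₁ w₂ p).natDegree ≤ N ↔ ∀ a b, coeff (expo a b) p ≠ 0 → w₁ * a + w₂ * b ≤ N := by
  rw [Polynomial.natDegree_le_iff_coeff_eq_zero]
  constructor
  · intro h a b hab
    by_contra! hN
    rw [← coeff_weightHom w₁ w₂ hw₂, h _ hN, Polynomial.coeff_zero] at hab
    exact hab rfl
  · intro h i hi
    ext a
    rw [Polynomial.coeff_zero]
    by_contra ha
    obtain ⟨b, rfl, hb⟩ := exists_of_coeff_weightHom_ne_zero hw₂ ha
    exact absurd (h a b hb) (by omega)

lemma coeffDeriv_weightHom (w₁ w₂ : ℕ) (p : P) :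
    coeffDeriv (weightHom w₁ w₂ p) = Polynomial.X ^ w₁ * weightHom w₁ w₂ (pderiv 0 p) := by
  have hX : coeffDeriv Polynomial.X = 0 := by
    ext1 i
    rw [coeff_coeffDeriv, Polynomial.coeff_X]
    split_ifs <;> simp
  have hCX : coeffDeriv (Polynomial.C Polynomial.X) = 1 := by
    ext1 i
    rw [coeff_coeffDeriv, Polynomial.coeff_C, Polynomial.coeff_one]
    split_ifs <;> simp
  induction p using MvPolynomial.induction_on with
  | C r =>
    simp [coeffDeriv_C_C]
  | add p q hp hq => simp [hp, hq, mul_add]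
  | mul_X p i hp =>
    rw [map_mul, Derivation.leibniz, hp, Derivation.leibniz]
    fin_cases i
    · simp [weightHom_X_zero, Derivation.leibniz, Derivation.leibniz_pow, hX, hCX]
      ring
    · simp [weightHom_X_one, Derivation.leibniz_pow, hX, pderiv_X]
      ring

lemma eulerDeriv_weightHom (w₁ w₂ : ℕ) (p : P) :
    eulerDeriv (weightHom w₁ w₂ p) =
      (w₁ : ℂ[X][X]) * (Polynomial.C Polynomial.X * Polynomial.X ^ w₁) *
        weightHom w₁ w₂ (pderiv 0 p) +
      (w₂ : ℂ[X][X]) * Polynomial.X ^ w₂ * weightHom w₁ w₂ (pderiv 1 p) := by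
  have hX (j : ℕ) : eulerDeriv (Polynomial.X ^ j) = (j : ℂ[X][X]) * Polynomial.X ^ j := by
    rw [eulerDeriv_apply]
    rcases j with _ | j
    · simp
    · rw [Polynomial.derivative_X_pow_succ]
      simp
      ring
  have hCX : eulerDeriv (Polynomial.C Polynomial.X) = 0 := by
    rw [eulerDeriv_apply]
    simp
  induction p using MvPolynomial.induction_on with
  | C r =>
    simp [eulerDeriv_C_C]
  | add p q hp hq => simp [hp, hq, mul_add]; ring
  | mul_X p i hp =>
    rw [map_mul, Derivation.leibniz, hp, Derivation.leibniz, Derivation.leibniz]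
    fin_cases i
    · simp [weightHom_X_zero, Derivation.leibniz, hX, hCX, pderiv_X]
      ring
    · simp [weightHom_X_one, hX, pderiv_X]
      ring

lemma bracket_weightHom (w₁ w₂ : ℕ) (p q : P) :
    bracket (weightHom w₁ w₂ p) (weightHom w₁ w₂ q) =
      Polynomial.X ^ (w₁ + w₂) * ((w₂ : ℂ[X][X]) * weightHom w₁ w₂ (jacDet p q)) := by
  simp only [bracket, coeffDeriv_weightHom, eulerDeriv_weightHom, jacDet, map_sub, map_mul]
  ring

/-- A polynomial with a Jacobian mate. -/
def HasMate (p : P) : Prop := ∃ (q : P) (c : ℂ), c ≠ 0 ∧ jacDet p q = C c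

/-- The edge polynomial of a polynomial with a Jacobian mate has few distinct roots. -/
lemma HasMate.card_roots_edge {p : P} (hp : HasMate p) (w₁ w₂ N : ℕ) (hw₂ : 0 < w₂) (hN : 0 < N)
    (hle : ∀ a b, coeff (expo a b) p ≠ 0 → w₁ * a + w₂ * b ≤ N)
    (hex : ∃ a b, coeff (expo a b) p ≠ 0 ∧ w₁ * a + w₂ * b = N) :
    ((weightHom w₁ w₂ p).coeff N).roots.toFinset.card ≤ 1 ∨
      ((weightHom w₁ w₂ p).coeff N).roots.toFinset.card * N ≤
        (w₁ + w₂) * ((weightHom w₁ w₂ p).coeff N).natDegree := by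
  obtain ⟨q, c, hc, hpq⟩ := hp
  obtain ⟨a₀, b₀, hab, habN⟩ := hex
  set F := weightHom w₁ w₂ p with hF
  have hcF : F.coeff N ≠ 0 := by
    intro h
    apply hab
    rw [← coeff_weightHom w₁ w₂ hw₂, habN, ← hF, h, Polynomial.coeff_zero]
  have hdeg : F.natDegree = N :=
    le_antisymm ((natDegree_weightHom_le_iff hw₂).2 hle)
      (Polynomial.le_natDegree_of_ne_zero hcF)
  have hlead : F.leadingCoeff = F.coeff N := by rw [Polynomial.leadingCoeff, hdeg]
  have hl0 : F.leadingCoeff ≠ 0 := hlead ▸ hcF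
  set V : ℂ[X][X] := Polynomial.C (Polynomial.C ((w₂ : ℂ) * c)) with hV
  have hwc : (w₂ : ℂ) * c ≠ 0 := mul_ne_zero (by exact_mod_cast hw₂.ne') hc
  have hV0 : V ≠ 0 := by simpa [hV] using hwc
  have hbr : bracket F (weightHom w₁ w₂ q) = Polynomial.X ^ (w₁ + w₂) * V := by
    rw [hF, bracket_weightHom, hpq, hV, ← algebraMap_eq, AlgHom.commutes,
      show algebraMap ℂ ℂ[X][X] c = Polynomial.C (Polynomial.C c) from rfl]
    simp
  have hVd : V.natDegree = 0 := Polynomial.natDegree_C _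
  have hge : w₁ + w₂ + V.natDegree ≤ F.natDegree + (weightHom w₁ w₂ q).natDegree := by
    rw [add_comm (w₁ + w₂), ← Polynomial.natDegree_X_pow_mul (w₁ + w₂) hV0, ← hbr]
    exact natDegree_bracket_le _ _
  obtain ⟨g, e, l, T, S, κ, hT, hκ, he, hpow, hd⟩ :=
    exists_bracket_leadingCoeff F hl0 (w₁ + w₂)
      (F.natDegree + (weightHom w₁ w₂ q).natDegree - (w₁ + w₂ + V.natDegree))
      (weightHom w₁ w₂ q) V 1 0 ((w₂ : ℂ) * c) (by omega) (by omega) hV0 hbr one_pos hwc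
      (by rw [hV, Polynomial.leadingCoeff_C, pow_one, pow_zero, mul_one]) (by simp [hVd])
  have := card_roots_of_wronskian F.leadingCoeff g e F.natDegree l T S (w₁ + w₂) κ
    hT hκ hl0 he hpow hd (by omega)
  rwa [hdeg, hlead] at this

lemma eq_C_mul_X_sub_C_pow_of_card_roots_le_one (f : ℂ[X]) (hf : f ≠ 0)
    (h : f.roots.toFinset.card ≤ 1) :
    ∃ (r α : ℂ) (k : ℕ), r ≠ 0 ∧
      f = Polynomial.C r * (Polynomial.X - Polynomial.C α) ^ k := by
  have hs := (IsAlgClosed.splits f).eq_prod_roots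
  obtain ⟨α, hα⟩ : ∃ α, ∀ x ∈ f.roots, x = α := by
    obtain ⟨α, hα⟩ := Finset.card_le_one_iff_subset_singleton.1 h
    exact ⟨α, fun x hx => Finset.mem_singleton.1 (hα (Multiset.mem_toFinset.2 hx))⟩
  rw [Multiset.eq_replicate_card.2 hα] at hs
  refine ⟨f.leadingCoeff, α, f.roots.card, by simpa using hf, ?_⟩
  rw [Multiset.map_replicate, Multiset.prod_replicate] at hs
  exact hs

/-- An edge of sufficiently general direction carries a power of a single linear factor. -/
lemma HasMate.exists_edge_eq_pow {p : P} (hp : HasMate p) (w₁ w₂ N : ℕ) (hw₂ : 0 < w₂)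
    (hN : 0 < N) (hle : ∀ a b, coeff (expo a b) p ≠ 0 → w₁ * a + w₂ * b ≤ N)
    (hex : ∃ a b, coeff (expo a b) p ≠ 0 ∧ w₁ * a + w₂ * b = N)
    (hw : w₂ < w₁ ∨ (w₁ = 1 ∧ w₂ = 1 ∧ coeff (expo N 0) p = 0)) :
    ∃ (r α : ℂ) (k : ℕ), r ≠ 0 ∧
      (weightHom w₁ w₂ p).coeff N = Polynomial.C r * (Polynomial.X - Polynomial.C α) ^ k := by
  have h3 := hp.card_roots_edge w₁ w₂ N hw₂ hN hle hex
  set f := (weightHom w₁ w₂ p).coeff N with hf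
  have hf0 : f ≠ 0 := by
    obtain ⟨a, b, hab, rfl⟩ := hex
    intro h
    rw [← coeff_weightHom w₁ w₂ hw₂, ← hf, h, Polynomial.coeff_zero] at hab
    exact hab rfl
  refine eq_C_mul_X_sub_C_pow_of_card_roots_le_one f hf0 (h3.elim id fun h => ?_)
  by_contra! hlt
  have h4 : 2 * N ≤ (w₁ + w₂) * f.natDegree := le_trans (by gcongr; omega) h
  have hlc : ((weightHom w₁ w₂ p).coeff N).coeff f.natDegree ≠ 0 :=
    Polynomial.leadingCoeff_ne_zero.2 hf0
  obtain ⟨b, hb, hb0⟩ := exists_of_coeff_weightHom_ne_zero hw₂ hlc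
  rcases hw with hw | ⟨rfl, rfl, h0⟩
  · rcases Nat.eq_zero_or_pos f.natDegree with hd | hd
    · rw [hd] at h4
      omega
    · nlinarith
  · rw [show b = 0 by omega, show f.natDegree = N by omega] at hb0
    exact hb0 h0

lemma coeff_C_mul_X_sub_C_pow (r α : ℂ) (k a : ℕ) :
    (Polynomial.C r * (Polynomial.X - Polynomial.C α) ^ k).coeff a =
      r * ((-α) ^ (k - a) * (k.choose a : ℂ)) := by
  rw [Polynomial.coeff_C_mul, sub_eq_add_neg, ← Polynomial.C_neg, Polynomial.coeff_X_add_C_pow]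

/-- The chain rule for an endomorphism of the polynomial algebra in two variables. -/
lemma pderiv_algHom (ψ : P →ₐ[ℂ] P) (i : Fin 2) (p : P) :
    pderiv i (ψ p) = ψ (pderiv 0 p) * pderiv i (ψ (X 0)) +
      ψ (pderiv 1 p) * pderiv i (ψ (X 1)) := by
  induction p using MvPolynomial.induction_on with
  | C r => simp [← algebraMap_eq]
  | add p q hp hq =>
    simp only [map_add, hp, hq]
    ring
  | mul_X p j hp =>
    simp only [map_mul, Derivation.leibniz, hp, smul_eq_mul, map_add]
    fin_cases j
    · simp [pderiv_X]
      ring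
    · simp [pderiv_X]
      ring

lemma jacDet_algHom (ψ : P →ₐ[ℂ] P) (p q : P) :
    jacDet (ψ p) (ψ q) = ψ (jacDet p q) * jacDet (ψ (X 0)) (ψ (X 1)) := by
  simp only [jacDet, map_sub, map_mul, pderiv_algHom ψ _ p, pderiv_algHom ψ _ q]
  ring

lemma jacDet_X_X : jacDet (X 0 : P) (X 1) = 1 := by
  simp [jacDet, pderiv_X]

lemma algHom_apply_C (ψ : P →ₐ[ℂ] P) (r : ℂ) : ψ (C r) = C r := by
  rw [← algebraMap_eq, AlgHom.commutes]

lemma exists_eq_C_of_isUnit {p : P} (h : IsUnit p) : ∃ c : ℂ, c ≠ 0 ∧ p = C c := by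
  obtain ⟨c, hc, rfl⟩ := isUnit_iff_eq_C_of_isReduced.1 h
  exact ⟨c, hc.ne_zero, rfl⟩

lemma jacDet_algEquiv (τ : P ≃ₐ[ℂ] P) :
    ∃ c : ℂ, c ≠ 0 ∧ jacDet (τ (X 0)) (τ (X 1)) = C c := by
  apply exists_eq_C_of_isUnit
  have h : jacDet (τ (τ.symm (X 0))) (τ (τ.symm (X 1))) = _ :=
    jacDet_algHom (τ : P →ₐ[ℂ] P) (τ.symm (X 0)) (τ.symm (X 1))
  rw [AlgEquiv.apply_symm_apply, AlgEquiv.apply_symm_apply, jacDet_X_X] at h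
  exact IsUnit.of_mul_eq_one_right _ h.symm

lemma HasMate.map {p : P} (hp : HasMate p) (τ : P ≃ₐ[ℂ] P) : HasMate (τ p) := by
  obtain ⟨q, c, hc, h⟩ := hp
  obtain ⟨d, hd, hτ⟩ := jacDet_algEquiv τ
  refine ⟨τ q, c * d, mul_ne_zero hc hd, ?_⟩
  have h' : jacDet (τ p) (τ q) = τ (jacDet p q) * jacDet (τ (X 0)) (τ (X 1)) :=
    jacDet_algHom (τ : P →ₐ[ℂ] P) p q
  rw [h', h, hτ, map_mul, ← algebraMap_eq, AlgEquiv.commutes]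

lemma HasMate.totalDegree_pos {p : P} (hp : HasMate p) : 0 < p.totalDegree := by
  obtain ⟨q, c, hc, h⟩ := hp
  by_contra! h0
  rw [totalDegree_eq_zero_iff_eq_C.1 (Nat.le_zero.1 h0)] at h
  rw [jacDet, pderiv_C, pderiv_C, zero_mul, zero_mul, sub_zero, eq_comm, C_eq_zero] at h
  exact hc h

/-- A surjective ring endomorphism of a Noetherian ring is bijective. -/
lemma bijective_of_surjective_algHom {ψ : P →ₐ[ℂ] P} (h : Function.Surjective ψ) :
    Function.Bijective ψ := by
  refine ⟨?_, h⟩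
  have hs (n : ℕ) : Function.Surjective (ψ ^ n : P →ₐ[ℂ] P) := by
    rw [AlgHom.coe_pow]
    exact h.iterate n
  let K : ℕ →o Ideal P :=
    { toFun := fun n => RingHom.ker (ψ ^ n : P →ₐ[ℂ] P)
      monotone' := monotone_nat_of_le_succ fun n a ha => by
        rw [RingHom.mem_ker] at ha ⊢
        rw [pow_succ', AlgHom.mul_apply, ha, map_zero] }
  obtain ⟨n, hn⟩ := monotone_stabilizes_iff_noetherian.2 (inferInstance : IsNoetherian P P) K
  rw [injective_iff_map_eq_zero]
  intro a ha
  obtain ⟨b, rfl⟩ := hs n a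
  have hb : b ∈ K (n + 1) := by
    change (ψ ^ (n + 1) : P →ₐ[ℂ] P) b = 0
    rw [pow_succ', AlgHom.mul_apply, ha]
  rw [← hn (n + 1) (Nat.le_succ n)] at hb
  exact hb

lemma surjective_of_X_mem_range {ψ : P →ₐ[ℂ] P} (h₀ : X 0 ∈ ψ.range) (h₁ : X 1 ∈ ψ.range) :
    Function.Surjective ψ := by
  rw [← AlgHom.range_eq_top, eq_top_iff, ← adjoin_range_X]
  refine Algebra.adjoin_le ?_
  rintro _ ⟨i, rfl⟩
  fin_cases i
  · exact h₀
  · exact h₁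

/-- The automorphism exchanging the two variables. -/
noncomputable def swapEquiv : P ≃ₐ[ℂ] P := renameEquiv ℂ (Equiv.swap 0 1)

@[simp] lemma swapEquiv_X_zero : swapEquiv (X 0) = X 1 := by simp [swapEquiv]

@[simp] lemma swapEquiv_X_one : swapEquiv (X 1) = X 0 := by simp [swapEquiv]

lemma coeff_swapEquiv (p : P) (a b : ℕ) : coeff (expo a b) (swapEquiv p) = coeff (expo b a) p := by
  have : expo a b = (expo b a).mapDomain (Equiv.swap (0 : Fin 2) 1) := by
    simp [expo, Finsupp.mapDomain_add, Finsupp.mapDomain_single, add_comm]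
  rw [this, swapEquiv, renameEquiv_apply, coeff_rename_mapDomain _ (Equiv.injective _)]

lemma totalDegree_swapEquiv (p : P) : (swapEquiv p).totalDegree = p.totalDegree := by
  rw [swapEquiv, totalDegree_renameEquiv]

/-- The elementary automorphism `x ↦ x + h(y)`. -/
noncomputable def shear (h : ℂ[X]) : P ≃ₐ[ℂ] P :=
  AlgEquiv.ofAlgHom (aeval ![X 0 + Polynomial.aeval (X 1) h, X 1])
    (aeval ![X 0 - Polynomial.aeval (X 1) h, X 1])
    (by
      apply MvPolynomial.algHom_ext
      intro i
      fin_cases i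
      · simp [← Polynomial.aeval_algHom_apply]
      · simp)
    (by
      apply MvPolynomial.algHom_ext
      intro i
      fin_cases i
      · simp [← Polynomial.aeval_algHom_apply]
      · simp)

@[simp] lemma shear_X_zero (h : ℂ[X]) : shear h (X 0) = X 0 + Polynomial.aeval (X 1) h := by
  simp [shear]

@[simp] lemma shear_X_one (h : ℂ[X]) : shear h (X 1) = X 1 := by
  simp [shear]

lemma coeff_X_mul_pderiv (i : Fin 2) (p : P) (m : Fin 2 →₀ ℕ) :
    coeff m (X i * pderiv i p) = (m i : ℂ) * coeff m p := by
  rw [mul_comm, coeff_mul_X', coeff_pderiv]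
  split_ifs with h
  · have hi : m i ≠ 0 := Finsupp.mem_support_iff.1 h
    have h1 : m - Finsupp.single i 1 + Finsupp.single i 1 = m :=
      tsub_add_cancel_of_le (Finsupp.single_le_iff.2 (Nat.one_le_iff_ne_zero.2 hi))
    rw [h1, mul_comm]
    congr 1
    rw [Finsupp.tsub_apply, Finsupp.single_eq_same]
    exact_mod_cast Nat.sub_add_cancel (Nat.one_le_iff_ne_zero.2 hi)
  · rw [Finsupp.notMem_support_iff.1 h]
    simp

lemma coeff_X_mul_X_mul_jacDet (p q : P) (m : Fin 2 →₀ ℕ) :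
    coeff m (X 0 * X 1 * jacDet p q) = ∑ u ∈ Finset.HasAntidiagonal.antidiagonal m,
      ((u.1 0 : ℂ) * u.2 1 - u.1 1 * u.2 0) * (coeff u.1 p * coeff u.2 q) := by
  have h : X 0 * X 1 * jacDet p q = (X 0 * pderiv 0 p) * (X 1 * pderiv 1 q) -
      (X 1 * pderiv 1 p) * (X 0 * pderiv 0 q) := by
    rw [jacDet]
    ring
  rw [h, coeff_sub, coeff_mul, coeff_mul, ← Finset.sum_sub_distrib]
  refine Finset.sum_congr rfl fun u _ => ?_
  simp only [coeff_X_mul_pderiv]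
  ring

/-- Under these normalizations along the line `y = 0`, no monomial of `p` is divisible by `xy`. -/
lemma eq_zero_of_jacDet_of_normalized (p q : P) (c : ℂ) (h : jacDet p q = C c)
    (hp0 : coeff (expo 1 0) p ≠ 0) (hp : ∀ m : Fin 2 →₀ ℕ, coeff m p ≠ 0 → m 1 = 0 → m 0 ≤ 1)
    (hq0 : coeff (expo 0 1) q ≠ 0) (hq : ∀ m : Fin 2 →₀ ℕ, coeff m q ≠ 0 → m 1 ≠ 0)
    (hq1 : ∀ m : Fin 2 →₀ ℕ, coeff m q ≠ 0 → m 1 = 1 → m 0 = 0)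
    (n : Fin 2 →₀ ℕ) (hn0 : 1 ≤ n 0) (hn1 : 1 ≤ n 1) : coeff n p = 0 := by
  classical
  by_contra hn
  set S : Finset ℚ := (p.support.filter fun m => 1 ≤ m 1).image
      (fun m => ((m 0 : ℚ) - 1) / m 1) ∪
    (q.support.filter fun m => 2 ≤ m 1).image (fun m => (m 0 : ℚ) / ((m 1 : ℚ) - 1)) with hS
  have hnS : ((n 0 : ℚ) - 1) / n 1 ∈ S := by
    refine Finset.mem_union_left _ (Finset.mem_image.2 ⟨n, ?_, rfl⟩)
    rw [Finset.mem_filter, mem_support_iff]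
    exact ⟨hn, hn1⟩
  set σ := S.max' ⟨_, hnS⟩ with hσ
  have hσ0 : 0 ≤ σ := by
    refine le_trans ?_ (S.le_max' _ hnS)
    have : (1 : ℚ) ≤ n 0 := by exact_mod_cast hn0
    exact div_nonneg (by linarith) (Nat.cast_nonneg _)
  have hwp : ∀ m : Fin 2 →₀ ℕ, coeff m p ≠ 0 → (m 0 : ℚ) - σ * m 1 ≤ 1 := by
    intro m hm
    rcases Nat.eq_zero_or_pos (m 1) with h0 | h0
    · have := hp m hm h0
      rw [h0, Nat.cast_zero, mul_zero, sub_zero]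
      exact_mod_cast this
    · have hle : ((m 0 : ℚ) - 1) / m 1 ≤ σ := S.le_max' _
        (Finset.mem_union_left _ (Finset.mem_image.2
          ⟨m, by simpa using ⟨hm, h0⟩, rfl⟩))
      rw [div_le_iff₀ (by exact_mod_cast h0)] at hle
      linarith
  have hwq : ∀ m : Fin 2 →₀ ℕ, coeff m q ≠ 0 → (m 0 : ℚ) - σ * m 1 ≤ -σ := by
    intro m hm
    have h0 := hq m hm
    by_cases h1 : m 1 = 1
    · rw [h1, hq1 m hm h1]
      simp
    · have h2 : 2 ≤ m 1 := by omega
      have hle : (m 0 : ℚ) / ((m 1 : ℚ) - 1) ≤ σ := S.le_max' _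
        (Finset.mem_union_right _ (Finset.mem_image.2 ⟨m, by simpa using ⟨hm, h2⟩, rfl⟩))
      have h3 : (2 : ℚ) ≤ m 1 := by exact_mod_cast h2
      rw [div_le_iff₀ (by linarith)] at hle
      linarith
  have hatt : (∃ m : Fin 2 →₀ ℕ, coeff m p ≠ 0 ∧ (m 0 : ℚ) - σ * m 1 = 1 ∧ 1 ≤ m 1) ∨
      (∃ m : Fin 2 →₀ ℕ, coeff m q ≠ 0 ∧ (m 0 : ℚ) - σ * m 1 = -σ ∧ 2 ≤ m 1) := by
    have hmem : σ ∈ S := S.max'_mem _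
    rw [hS, Finset.mem_union, Finset.mem_image, Finset.mem_image] at hmem
    rcases hmem with ⟨m, hm, he⟩ | ⟨m, hm, he⟩ <;>
      rw [Finset.mem_filter, mem_support_iff] at hm
    · left
      refine ⟨m, hm.1, ?_, hm.2⟩
      have : (1 : ℚ) ≤ m 1 := by exact_mod_cast hm.2
      rw [← he]
      field_simp
      ring
    · right
      refine ⟨m, hm.1, ?_, hm.2⟩
      have h3 : (2 : ℚ) ≤ m 1 := by exact_mod_cast hm.2
      have h4 : (m 1 : ℚ) - 1 ≠ 0 := by linarith
      rw [← he]
      field_simp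
      ring
  obtain ⟨u, hu, humax⟩ := (p.support.filter fun m => (m 0 : ℚ) - σ * m 1 = 1).exists_max_image
    (fun m => m 1) ⟨expo 1 0, by simpa using hp0⟩
  obtain ⟨v, hv, hvmax⟩ := (q.support.filter fun m => (m 0 : ℚ) - σ * m 1 = -σ).exists_max_image
    (fun m => m 1) ⟨expo 0 1, by simpa using hq0⟩
  simp only [Finset.mem_filter, mem_support_iff, and_imp] at hu hv humax hvmax
  have hv1 := hq v hv.1
  have huv : 2 ≤ u 1 + v 1 := by
    rcases hatt with ⟨m, h1, h2, h3⟩ | ⟨m, h1, h2, h3⟩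
    · have := humax m h1 h2
      omega
    · have := hvmax m h1 h2
      omega
  have hzero : coeff (u + v) (X 0 * X 1 * jacDet p q) = 0 := by
    have hm : (X 0 * X 1 * C c : P) = monomial (expo 1 1) c := by
      simp only [X, C_apply, monomial_mul, expo]
      simp
    rw [h, hm, coeff_monomial, if_neg]
    intro he
    have := DFunLike.congr_fun he 1
    rw [expo_one, Finsupp.add_apply] at this
    omega
  rw [coeff_X_mul_X_mul_jacDet, Finset.sum_eq_single (u, v)] at hzero
  · have hdet : ((u 0 : ℚ) * v 1 - u 1 * v 0) ≠ 0 := by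
      have h1 : (1 : ℚ) ≤ v 1 := by exact_mod_cast Nat.one_le_iff_ne_zero.2 hv1
      have h2 : 0 ≤ σ * u 1 := mul_nonneg hσ0 (Nat.cast_nonneg _)
      have h3 : (u 0 : ℚ) * v 1 - u 1 * v 0 = v 1 + σ * u 1 := by
        linear_combination (v 1 : ℚ) * hu.2 - (u 1 : ℚ) * hv.2
      rw [h3]
      linarith
    have hdet' : ((u 0 : ℂ) * v 1 - u 1 * v 0) ≠ 0 := by
      rw [sub_ne_zero] at hdet ⊢
      exact_mod_cast hdet
    exact mul_ne_zero hdet' (mul_ne_zero hu.1 hv.1) hzero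
  · rintro ⟨a, b⟩ hab hne
    rw [Finset.HasAntidiagonal.mem_antidiagonal] at hab
    by_cases ha : coeff a p = 0
    · simp [ha]
    by_cases hb : coeff b q = 0
    · simp [hb]
    exfalso
    have h0 : a 0 + b 0 = u 0 + v 0 := DFunLike.congr_fun hab 0
    have h1 : a 1 + b 1 = u 1 + v 1 := DFunLike.congr_fun hab 1
    have h0' : (a 0 : ℚ) + b 0 = u 0 + v 0 := by exact_mod_cast h0
    have h1' : (a 1 : ℚ) + b 1 = u 1 + v 1 := by exact_mod_cast h1
    have hsum : ((a 0 : ℚ) - σ * a 1) + (b 0 - σ * b 1) = 1 + -σ := by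
      linear_combination h0' - σ * h1' + hu.2 + hv.2
    have h2 := hwp a ha
    have h3 := hwq b hb
    have ha' : (a 0 : ℚ) - σ * a 1 = 1 := by linarith
    have hb' : (b 0 : ℚ) - σ * b 1 = -σ := by linarith
    have h4 := humax a ha ha'
    have h5 := hvmax b hb hb'
    have h6 : a 1 = u 1 := by omega
    have h7 : a 0 = u 0 := by
      have : (a 0 : ℚ) = u 0 := by
        rw [h6] at ha'
        linarith [hu.2]
      exact_mod_cast this
    have hau : a = u := by rw [← expo_eta a, ← expo_eta u, h6, h7]
    subst hau
    exact hne (congrArg (Prod.mk a) (add_left_cancel hab))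
  · intro hne
    exact absurd (Finset.HasAntidiagonal.mem_antidiagonal (a := (u, v)).2 rfl) hne

/-- Restriction to the line `y = 0`. -/
noncomputable def restrictLine : P →ₐ[ℂ] ℂ[X] := aeval ![Polynomial.X, 0]

lemma coeff_restrictLine (p : P) (s : ℕ) : (restrictLine p).coeff s = coeff (expo s 0) p := by
  induction p using MvPolynomial.induction_on' with
  | add p q hp hq => simp [hp, hq]
  | monomial m r =>
    rw [restrictLine, aeval_monomial, Finsupp.prod_fintype _ _ (by simp), coeff_monomial]
    simp only [Fin.prod_univ_two, Matrix.cons_val_zero, Matrix.cons_val_one, expo_eq_iff,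
      zero_pow_eq, Polynomial.algebraMap_eq]
    by_cases h : m 1 = 0
    · simp [h, Polynomial.coeff_X_pow, eq_comm]
    · simp [h]

lemma restrictLine_pderiv_zero (p : P) :
    restrictLine (pderiv 0 p) = Polynomial.derivative (restrictLine p) := by
  ext s
  have h : expo s 0 + Finsupp.single 0 1 = expo (s + 1) 0 := by
    rw [expo_eq_iff]
    simp
  rw [coeff_restrictLine, coeff_pderiv, Polynomial.coeff_derivative, coeff_restrictLine, h,
    expo_zero]

lemma coeff_restrictLine_pderiv_one (p : P) (s : ℕ) :
    (restrictLine (pderiv 1 p)).coeff s = coeff (expo s 1) p := by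
  have h : expo s 0 + Finsupp.single 1 1 = expo s 1 := by
    rw [expo_eq_iff]
    simp
  rw [coeff_restrictLine, coeff_pderiv, h, expo_one]
  simp

lemma eq_C_of_aeval_eq_zero {u : P} {h : ℂ[X]} (hh : h ≠ 0) (hu : Polynomial.aeval u h = 0) :
    ∃ a : ℂ, u = C a := by
  have hs := (IsAlgClosed.splits h).eq_prod_roots
  rw [hs, map_mul, map_multiset_prod, Polynomial.aeval_C, algebraMap_eq, mul_eq_zero,
    C_eq_zero, Polynomial.leadingCoeff_eq_zero, or_iff_right hh, Multiset.prod_eq_zero_iff] at hu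
  simp only [Multiset.map_map, Multiset.mem_map, Function.comp_apply, map_sub,
    Polynomial.aeval_X, Polynomial.aeval_C, algebraMap_eq, sub_eq_zero] at hu
  obtain ⟨a, -, ha⟩ := hu
  exact ⟨a, ha⟩

lemma pderiv_polynomial_aeval (i : Fin 2) (u : P) (g : ℂ[X]) :
    pderiv i (Polynomial.aeval u g) =
      Polynomial.aeval u (Polynomial.derivative g) * pderiv i u := by
  simp

lemma jacDet_polynomial_aeval_left (u q : P) (g : ℂ[X]) :
    jacDet (Polynomial.aeval u g) q =
      Polynomial.aeval u (Polynomial.derivative g) * jacDet u q := by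
  simp only [jacDet, pderiv_polynomial_aeval]
  ring

lemma jacDet_polynomial_aeval_self (p : P) (k : ℂ[X]) :
    jacDet p (Polynomial.aeval p k) = 0 := by
  simp only [jacDet, pderiv_polynomial_aeval]
  ring

lemma pderiv_pderiv_eq_zero_of_restrictLine (p : P) (hp : HasMate p) (d : ℂ) (hd : d ≠ 0)
    (h : Polynomial.derivative (restrictLine p) = Polynomial.C d) :
    pderiv 0 (pderiv 1 p) = 0 := by
  obtain ⟨q, c, hc, hpq⟩ := hp
  set g := restrictLine p with hg
  have hg' (s : ℕ) : g.coeff (s + 1) * ((s : ℂ) + 1) = (Polynomial.C d).coeff s := by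
    rw [← h, Polynomial.coeff_derivative]
  have hg1 : g.coeff 1 = d := by simpa using hg' 0
  have hg2 (s : ℕ) (hs : g.coeff s ≠ 0) : s ≤ 1 := by
    by_contra! hs'
    obtain ⟨t, rfl⟩ : ∃ t, s = t + 1 + 1 := ⟨s - 2, by omega⟩
    have h1 := hg' (t + 1)
    rw [Polynomial.coeff_C_succ, mul_eq_zero] at h1
    rcases h1 with h1 | h1
    · exact hs h1
    · norm_cast at h1
  have hglin : g = Polynomial.C d * Polynomial.X + Polynomial.C (g.coeff 0) := by
    rw [← hg1]
    refine Polynomial.eq_X_add_C_of_natDegree_le_one ?_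
    refine Polynomial.natDegree_le_iff_coeff_eq_zero.2 fun s hs => ?_
    by_contra h1
    exact absurd (hg2 s h1) (by omega)
  set k : ℂ[X] := (restrictLine q).comp
    (Polynomial.C d⁻¹ * (Polynomial.X - Polynomial.C (g.coeff 0))) with hk
  set q' := q - Polynomial.aeval p k with hq'
  have hpq' : jacDet p q' = C c := by
    have h1 : jacDet p q' = jacDet p q - jacDet p (Polynomial.aeval p k) := by
      simp only [hq', jacDet, map_sub]
      ring
    rw [h1, hpq, jacDet_polynomial_aeval_self, sub_zero]
  have hq'0 : restrictLine q' = 0 := by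
    rw [hq', map_sub, ← Polynomial.aeval_algHom_apply, ← hg, hk, Polynomial.aeval_comp]
    have h1 : Polynomial.aeval g (Polynomial.C d⁻¹ * (Polynomial.X - Polynomial.C (g.coeff 0))) =
        (Polynomial.X : ℂ[X]) := by
      rw [map_mul, map_sub, Polynomial.aeval_C, Polynomial.aeval_C, Polynomial.aeval_X]
      conv_lhs => rw [hglin]
      simp [← mul_assoc, ← Polynomial.C_mul, inv_mul_cancel₀ hd]
    rw [h1, Polynomial.aeval_X_left_apply, sub_self]
  have hq'1 : Polynomial.C d * restrictLine (pderiv 1 q') = Polynomial.C c := by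
    have h1 := congrArg restrictLine hpq'
    rw [jacDet, map_sub, map_mul, map_mul, restrictLine_pderiv_zero, restrictLine_pderiv_zero,
      hq'0, ← hg, h, ← algebraMap_eq, AlgHom.commutes] at h1
    simpa using h1
  have hq'1c (s : ℕ) : d * coeff (expo s 1) q' = (Polynomial.C c).coeff s := by
    rw [← hq'1, Polynomial.coeff_C_mul, coeff_restrictLine_pderiv_one]
  have key := eq_zero_of_jacDet_of_normalized p q' c hpq'
    (by rw [← coeff_restrictLine, ← hg, hg1]; exact hd)
    (fun m hm h0 => hg2 _ (by rwa [hg, coeff_restrictLine, ← h0, expo_eta]))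
    (by
      intro h0
      have h1 := hq'1c 0
      rw [h0, mul_zero, Polynomial.coeff_C_zero] at h1
      exact hc h1.symm)
    (fun m hm h0 => hm (by rw [← expo_eta m, h0, ← coeff_restrictLine, hq'0]; simp))
    (by
      intro m hm h1
      by_contra h0
      obtain ⟨t, ht⟩ := Nat.exists_eq_succ_of_ne_zero h0
      have h2 := hq'1c (m 0)
      rw [show expo (m 0) 1 = m by rw [eq_comm, expo_eq_iff]; exact ⟨rfl, h1⟩, ht,
        Polynomial.coeff_C_succ] at h2
      exact mul_ne_zero hd hm h2)
  ext m
  rw [coeff_pderiv, coeff_pderiv, key _ (by simp) (by simp)]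
  simp

/-- A polynomial with a Jacobian mate which factors through a polynomial map with constant second
coordinate is a sum of univariate polynomials. -/
lemma HasMate.pderiv_pderiv_eq_zero {p : P} (hp : HasMate p) (ψ : P →ₐ[ℂ] P) (hψ : ψ p = p)
    (v₀ : ℂ) (hv : ψ (X 1) = C v₀) : pderiv 0 (pderiv 1 p) = 0 := by
  set u := ψ (X 0) with hu
  set τ : P ≃ₐ[ℂ] P := swapEquiv.trans ((shear (Polynomial.C v₀)).trans swapEquiv) with hτ
  have hτ0 : τ (X 0) = X 0 := by simp [τ]
  have hτ1 : τ (X 1) = X 1 + C v₀ := by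
    have h : swapEquiv (C v₀) = C v₀ := swapEquiv.commutes v₀
    simp [τ, h]
  set g : ℂ[X] := restrictLine (τ p) with hg
  have hpg : p = Polynomial.aeval u g := by
    have h : ψ = (Polynomial.aeval u).comp (restrictLine.comp (τ : P →ₐ[ℂ] P)) := by
      apply MvPolynomial.algHom_ext
      intro i
      fin_cases i
      · simp [hτ0, restrictLine, ← hu]
      · simp [hτ1, restrictLine, hv]
    conv_lhs => rw [← hψ, h]
    rfl
  have hu0 : ¬ ∃ a : ℂ, u = C a := by
    rintro ⟨a, ha⟩
    have h := hp.totalDegree_pos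
    rw [hpg, ha, ← algebraMap_eq, Polynomial.aeval_algebraMap_apply, algebraMap_eq,
      totalDegree_C] at h
    exact lt_irrefl _ h
  obtain ⟨d, hd, hgd⟩ : ∃ d : ℂ, d ≠ 0 ∧
      Polynomial.aeval u (Polynomial.derivative g) = C d := by
    apply exists_eq_C_of_isUnit
    obtain ⟨q, c, hc, hpq⟩ := hp
    rw [hpg, jacDet_polynomial_aeval_left] at hpq
    exact isUnit_of_mul_isUnit_left (hpq ▸ (isUnit_iff_ne_zero.2 hc).map C)
  have hg' : Polynomial.derivative g = Polynomial.C d := by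
    by_contra h
    refine hu0 (eq_C_of_aeval_eq_zero (sub_ne_zero.2 h) ?_)
    rw [map_sub, hgd, Polynomial.aeval_C, algebraMap_eq, sub_self]
  have h0 := pderiv_pderiv_eq_zero_of_restrictLine (τ p) (hp.map τ) d hd hg'
  have hpd0 (r : P) : pderiv 0 (τ r) = τ (pderiv 0 r) := by
    have h := pderiv_algHom (τ : P →ₐ[ℂ] P) 0 r
    simpa [hτ0, hτ1, pderiv_X] using h
  have hpd1 (r : P) : pderiv 1 (τ r) = τ (pderiv 1 r) := by
    have h := pderiv_algHom (τ : P →ₐ[ℂ] P) 1 r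
    simpa [hτ0, hτ1, pderiv_X] using h
  rwa [hpd1, hpd0, EmbeddingLike.map_eq_zero_iff] at h0

lemma coeff_expo_pderiv_zero (p : P) (a b : ℕ) :
    coeff (expo a b) (pderiv 0 p) = coeff (expo (a + 1) b) p * ((a : ℂ) + 1) := by
  have h : expo a b + Finsupp.single 0 1 = expo (a + 1) b := by
    rw [expo_eq_iff]
    simp
  rw [coeff_pderiv, h, expo_zero]

lemma coeff_expo_pderiv_one (p : P) (a b : ℕ) :
    coeff (expo a b) (pderiv 1 p) = coeff (expo a (b + 1)) p * ((b : ℂ) + 1) := by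
  have h : expo a b + Finsupp.single 1 1 = expo a (b + 1) := by
    rw [expo_eq_iff]
    simp
  rw [coeff_pderiv, h, expo_one]

/-- The monomial `x ^ (a + 1) * y ^ (b + 1)` occurs in `p` and every other monomial of `p`
divides it. -/
def HasCorner (p : P) (a b : ℕ) : Prop :=
  coeff (expo (a + 1) (b + 1)) p ≠ 0 ∧
    ∀ m : Fin 2 →₀ ℕ, coeff m p ≠ 0 → m 0 ≤ a + 1 ∧ m 1 ≤ b + 1

lemma HasCorner.swap {p : P} {a b : ℕ} (h : HasCorner p a b) : HasCorner (swapEquiv p) b a := by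
  refine ⟨by rw [coeff_swapEquiv]; exact h.1, fun m hm => ?_⟩
  rw [← expo_eta m, coeff_swapEquiv] at hm
  simpa [and_comm] using h.2 _ hm

lemma HasCorner.pderiv_pderiv_ne_zero {p : P} {a b : ℕ} (h : HasCorner p a b) :
    pderiv 0 (pderiv 1 p) ≠ 0 := by
  intro h0
  have h1 : coeff (expo a b) (pderiv 0 (pderiv 1 p)) = 0 := by rw [h0, coeff_zero]
  rw [coeff_expo_pderiv_zero, coeff_expo_pderiv_one] at h1
  exact mul_ne_zero (mul_ne_zero h.1 (Nat.cast_add_one_ne_zero b)) (Nat.cast_add_one_ne_zero a) h1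

lemma algHom_monomial (ψ : P →ₐ[ℂ] P) (m : Fin 2 →₀ ℕ) (r : ℂ) :
    ψ (monomial m r) = C r * (ψ (X 0) ^ m 0 * ψ (X 1) ^ m 1) := by
  rw [monomial_eq, map_mul, algHom_apply_C, Finsupp.prod_fintype _ _ (by simp), Fin.prod_univ_two]
  simp

lemma totalDegree_algHom_monomial_le (ψ : P →ₐ[ℂ] P) (m : Fin 2 →₀ ℕ) (r : ℂ) :
    (ψ (monomial m r)).totalDegree ≤
      m 0 * (ψ (X 0)).totalDegree + m 1 * (ψ (X 1)).totalDegree := by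
  rw [algHom_monomial]
  refine (totalDegree_mul _ _).trans ?_
  rw [totalDegree_C, zero_add]
  exact (totalDegree_mul _ _).trans (add_le_add (totalDegree_pow _ _) (totalDegree_pow _ _))

lemma totalDegree_pow_eq (u : P) (hu : u ≠ 0) (n : ℕ) :
    (u ^ n).totalDegree = n * u.totalDegree := by
  induction n with
  | zero => simp
  | succ n ih =>
    rw [pow_succ, totalDegree_mul_of_isDomain (pow_ne_zero _ hu) hu, ih]
    ring

lemma HasCorner.totalDegree_algHom {p : P} {a b : ℕ} (h : HasCorner p a b) (ψ : P →ₐ[ℂ] P)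
    (h0 : 0 < (ψ (X 0)).totalDegree) (h1 : 0 < (ψ (X 1)).totalDegree) :
    (ψ p).totalDegree =
      (a + 1) * (ψ (X 0)).totalDegree + (b + 1) * (ψ (X 1)).totalDegree := by
  have hu : ψ (X 0) ≠ 0 := fun h => by simp [h] at h0
  have hv : ψ (X 1) ≠ 0 := fun h => by simp [h] at h1
  set d := (a + 1) * (ψ (X 0)).totalDegree + (b + 1) * (ψ (X 1)).totalDegree with hd
  have hd0 : 0 < d := by positivity
  have hcorner : (ψ (monomial (expo (a + 1) (b + 1)) (coeff (expo (a + 1) (b + 1)) p))).totalDegree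
      = d := by
    rw [algHom_monomial, totalDegree_mul_of_isDomain (by simpa using h.1)
      (mul_ne_zero (pow_ne_zero _ hu) (pow_ne_zero _ hv)), totalDegree_C,
      totalDegree_mul_of_isDomain (pow_ne_zero _ hu) (pow_ne_zero _ hv),
      totalDegree_pow_eq _ hu, totalDegree_pow_eq _ hv, expo_zero, expo_one, zero_add]
  conv_lhs => rw [p.as_sum]
  rw [← Finset.add_sum_erase _ _ (mem_support_iff.2 h.1), map_add,
    totalDegree_add_eq_left_of_totalDegree_lt, hcorner]
  rw [hcorner, map_sum]
  refine (totalDegree_finsetSum_le (d := d - 1) fun m hm => ?_).trans_lt (by omega)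
  rw [Finset.mem_erase, mem_support_iff] at hm
  refine (totalDegree_algHom_monomial_le ψ m _).trans (Nat.le_sub_one_of_lt ?_)
  obtain ⟨h2, h3⟩ := h.2 m hm.2
  have hne : m 0 < a + 1 ∨ m 1 < b + 1 := by
    by_contra! hlt
    exact hm.1 ((expo_eq_iff _ _ _).2 ⟨by omega, by omega⟩)
  rcases hne with hlt | hlt
  · exact add_lt_add_of_lt_of_le (by gcongr) (by gcongr)
  · exact add_lt_add_of_le_of_lt (by gcongr) (by gcongr)

lemma exists_eq_linear_of_totalDegree_le_one (u : P) (hu : u.totalDegree ≤ 1) :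
    ∃ a b c : ℂ, u = C a * X 0 + C b * X 1 + C c := by
  refine ⟨coeff (expo 1 0) u, coeff (expo 0 1) u, coeff (expo 0 0) u, ?_⟩
  have hX0 : (C (coeff (expo 1 0) u) * X 0 : P) = monomial (expo 1 0) (coeff (expo 1 0) u) := by
    rw [C_mul_X_eq_monomial]
    simp [expo]
  have hX1 : (C (coeff (expo 0 1) u) * X 1 : P) = monomial (expo 0 1) (coeff (expo 0 1) u) := by
    rw [C_mul_X_eq_monomial]
    simp [expo]
  have hC : (C (coeff (expo 0 0) u) : P) = monomial (expo 0 0) (coeff (expo 0 0) u) := by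
    rw [C_apply]
    simp [expo]
  rw [hX0, hX1, hC]
  ext m
  obtain ⟨s, t, rfl⟩ : ∃ s t, m = expo s t := ⟨m 0, m 1, (expo_eta m).symm⟩
  simp only [coeff_add, coeff_monomial, expo_eq_iff, expo_zero, expo_one]
  by_cases hst : 1 < s + t
  · have h0 : coeff (expo s t) u = 0 := by
      apply coeff_eq_zero_of_totalDegree_lt
      rw [← Finsupp.degree_apply, Finsupp.degree_eq_sum, Fin.sum_univ_two, expo_zero, expo_one]
      omega
    rw [h0, if_neg (by omega), if_neg (by omega), if_neg (by omega)]
    simp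
  · obtain ⟨rfl, rfl⟩ | ⟨rfl, rfl⟩ | ⟨rfl, rfl⟩ :
        (s = 0 ∧ t = 0) ∨ (s = 1 ∧ t = 0) ∨ (s = 0 ∧ t = 1) := by omega
    all_goals simp

/-- A polynomial with a corner and a Jacobian mate is a test polynomial. -/
lemma HasCorner.isTestPolynomial {p : P} {a b : ℕ} (h : HasCorner p a b) (hp : HasMate p) :
    IsTestPolynomial p := by
  intro ψ hψ
  have hv : 0 < (ψ (X 1)).totalDegree := by
    by_contra! h0
    exact h.pderiv_pderiv_ne_zero (hp.pderiv_pderiv_eq_zero ψ hψ _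
      (totalDegree_eq_zero_iff_eq_C.1 (Nat.le_zero.1 h0)))
  have hu : 0 < (ψ (X 0)).totalDegree := by
    by_contra! h0
    refine h.swap.pderiv_pderiv_ne_zero ((hp.map swapEquiv).pderiv_pderiv_eq_zero
      (((swapEquiv : P →ₐ[ℂ] P).comp ψ).comp (swapEquiv.symm : P →ₐ[ℂ] P)) ?_
      (coeff 0 (ψ (X 0))) ?_)
    · simp [hψ]
    · have h1 : swapEquiv.symm (X 1) = X 0 := by
        rw [AlgEquiv.symm_apply_eq, swapEquiv_X_zero]
      have h2 : swapEquiv (C (coeff 0 (ψ (X 0)))) = C (coeff 0 (ψ (X 0))) := swapEquiv.commutes _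
      have h3 := congrArg swapEquiv (totalDegree_eq_zero_iff_eq_C.1 (Nat.le_zero.1 h0))
      rw [h2] at h3
      simpa [h1] using h3
  have hd := h.totalDegree_algHom ψ hu hv
  have hd1 := h.totalDegree_algHom (AlgHom.id ℂ P) (by simp) (by simp)
  simp only [AlgHom.id_apply, totalDegree_X] at hd1
  rw [hψ, hd1] at hd
  have hdu : (ψ (X 0)).totalDegree ≤ 1 := by nlinarith
  have hdv : (ψ (X 1)).totalDegree ≤ 1 := by nlinarith
  obtain ⟨a₁, b₁, c₁, hu'⟩ := exists_eq_linear_of_totalDegree_le_one _ hdu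
  obtain ⟨a₂, b₂, c₂, hv'⟩ := exists_eq_linear_of_totalDegree_le_one _ hdv
  have hJ : jacDet (ψ (X 0)) (ψ (X 1)) = C (a₁ * b₂ - b₁ * a₂) := by
    rw [hu', hv']
    simp [jacDet, pderiv_X]
  by_cases hJ0 : a₁ * b₂ - b₁ * a₂ = 0
  · exfalso
    have h0 : jacDet (ψ (X 0)) p = 0 := by
      rw [← hψ, jacDet_algHom, hJ, hJ0, C_0, mul_zero]
    have h1 : C a₁ * pderiv 1 p - C b₁ * pderiv 0 p = 0 := by
      rw [← h0, jacDet, hu']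
      simp [pderiv_X]
    have hlt0 : coeff (expo (a + 1 + 1) b) p = 0 := by
      by_contra h2
      have := (h.2 _ h2).1
      rw [expo_zero] at this
      omega
    have hlt1 : coeff (expo a (b + 1 + 1)) p = 0 := by
      by_contra h2
      have := (h.2 _ h2).2
      rw [expo_one] at this
      omega
    have ha := congrArg (coeff (expo (a + 1) b)) h1
    have hb := congrArg (coeff (expo a (b + 1))) h1
    rw [coeff_sub, coeff_C_mul, coeff_C_mul, coeff_expo_pderiv_zero, coeff_expo_pderiv_one,
      coeff_zero] at ha hb
    have ha0 : a₁ = 0 := by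
      simpa [hlt0, h.1, Nat.cast_add_one_ne_zero] using ha
    have hb0 : b₁ = 0 := by
      simpa [hlt1, h.1, Nat.cast_add_one_ne_zero] using hb
    rw [hu', ha0, hb0] at hu
    simp at hu
  · have hC (r : ℂ) : (C r : P) ∈ ψ.range := ⟨C r, algHom_apply_C ψ r⟩
    have hJ' : (C (a₁ * b₂ - b₁ * a₂)⁻¹ * (C a₁ * C b₂ - C b₁ * C a₂) : P) = 1 := by
      rw [← C_mul, ← C_mul, ← C_sub, ← C_mul, inv_mul_cancel₀ hJ0, C_1]
    refine bijective_of_surjective_algHom (surjective_of_X_mem_range ?_ ?_)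
    · have : X 0 = C (a₁ * b₂ - b₁ * a₂)⁻¹ *
          (C b₂ * (ψ (X 0) - C c₁) - C b₁ * (ψ (X 1) - C c₂)) := by
        rw [hu', hv']
        linear_combination -X 0 * hJ'
      rw [this]
      exact mul_mem (hC _) (sub_mem (mul_mem (hC _) (sub_mem ⟨X 0, rfl⟩ (hC _)))
        (mul_mem (hC _) (sub_mem ⟨X 1, rfl⟩ (hC _))))
    · have : X 1 = C (a₁ * b₂ - b₁ * a₂)⁻¹ *
          (C a₁ * (ψ (X 1) - C c₂) - C a₂ * (ψ (X 0) - C c₁)) := by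
        rw [hu', hv']
        linear_combination -X 1 * hJ'
      rw [this]
      exact mul_mem (hC _) (sub_mem (mul_mem (hC _) (sub_mem ⟨X 1, rfl⟩ (hC _)))
        (mul_mem (hC _) (sub_mem ⟨X 0, rfl⟩ (hC _))))

lemma totalDegree_le_iff_expo {p : P} {n : ℕ} :
    p.totalDegree ≤ n ↔ ∀ a b, coeff (expo a b) p ≠ 0 → a + b ≤ n := by
  rw [totalDegree, Finset.sup_le_iff]
  have hs (m : Fin 2 →₀ ℕ) : (m.sum fun _ e => e) = m 0 + m 1 := by
    rw [Finsupp.sum_fintype _ _ fun _ => rfl, Fin.sum_univ_two]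
  constructor
  · intro h a b hab
    simpa [hs] using h _ (mem_support_iff.2 hab)
  · intro h m hm
    rw [hs]
    exact h _ _ (by rwa [expo_eta, ← mem_support_iff])

lemma weightHom_shear (K : ℕ) (α : ℂ) (p : P) :
    weightHom K 1 (shear (Polynomial.C α * Polynomial.X ^ K) p) =
      (weightHom K 1 p).map
        (Polynomial.aeval (Polynomial.X + Polynomial.C α) : ℂ[X] →ₐ[ℂ] ℂ[X]).toRingHom := by
  have h : (weightHom K 1).comp
      (shear (Polynomial.C α * Polynomial.X ^ K) : P →ₐ[ℂ] P) =
      (Polynomial.mapAlgHom (Polynomial.aeval (Polynomial.X + Polynomial.C α))).comp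
        (weightHom K 1) := by
    apply MvPolynomial.algHom_ext
    intro i
    fin_cases i
    · simp [weightHom_X_zero, weightHom_X_one, ← algebraMap_eq, Polynomial.algebraMap_apply]
      ring
    · simp [weightHom_X_one]
  exact DFunLike.congr_fun h p

lemma coeff_weightHom_shear (K : ℕ) (α : ℂ) (p : P) (N : ℕ) :
    (weightHom K 1 (shear (Polynomial.C α * Polynomial.X ^ K) p)).coeff N =
      ((weightHom K 1 p).coeff N).comp (Polynomial.X + Polynomial.C α) := by
  rw [weightHom_shear, Polynomial.coeff_map]
  rfl

lemma weight_le_of_shear {K : ℕ} (α : ℂ) {p : P} {N : ℕ}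
    (h : ∀ a b, coeff (expo a b) p ≠ 0 → K * a + 1 * b ≤ N) :
    ∀ a b, coeff (expo a b) (shear (Polynomial.C α * Polynomial.X ^ K) p) ≠ 0 →
      K * a + 1 * b ≤ N := by
  rw [← natDegree_weightHom_le_iff one_pos] at h ⊢
  rw [weightHom_shear]
  exact (Polynomial.natDegree_map_le).trans h

/-- The edge of `p` of slope `K` acquires a vanishing constant term after a suitable shear. -/
lemma exists_shear_coeff_eq_zero (K : ℕ) (p : P) (a b : ℕ) (ha : a ≠ 0)
    (hab : coeff (expo a b) p ≠ 0) : ∃ α : ℂ,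
      coeff (expo 0 (K * a + b)) (shear (Polynomial.C α * Polynomial.X ^ K) p) = 0 := by
  set f := (weightHom K 1 p).coeff (K * a + b) with hf
  have hfa : f.coeff a ≠ 0 := by
    rw [hf, ← one_mul b, coeff_weightHom _ _ one_pos]
    exact hab
  have hdeg : f.degree ≠ 0 := by
    intro h
    rw [Polynomial.eq_C_of_degree_le_zero h.le, Polynomial.coeff_C_of_ne_zero ha] at hfa
    exact hfa rfl
  obtain ⟨α, hα⟩ := IsAlgClosed.exists_root f hdeg
  refine ⟨α, ?_⟩
  have h := coeff_weightHom K 1 one_pos (shear (Polynomial.C α * Polynomial.X ^ K) p) 0 (K * a + b)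
  rw [mul_zero, zero_add, one_mul, coeff_weightHom_shear, ← hf] at h
  rw [← h, Polynomial.coeff_zero_eq_eval_zero, Polynomial.eval_comp]
  simpa using hα

/-- The total degree of `p` cannot be decreased by an automorphism. -/
def IsDegreeMinimal (p : P) : Prop := ∀ τ : P ≃ₐ[ℂ] P, p.totalDegree ≤ (τ p).totalDegree

lemma IsDegreeMinimal.map {p : P} (hp : IsDegreeMinimal p) (τ : P ≃ₐ[ℂ] P)
    (hτ : (τ p).totalDegree ≤ p.totalDegree) : IsDegreeMinimal (τ p) :=
  fun σ => hτ.trans (hp (τ.trans σ))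

/-- The only monomial of top degree in `p` is `x ^ i * y ^ j`. -/
def HasLeadingMonomial (p : P) (i j : ℕ) : Prop :=
  coeff (expo i j) p ≠ 0 ∧
    ∀ a b, coeff (expo a b) p ≠ 0 → a + b < i + j ∨ (a = i ∧ b = j)

lemma HasLeadingMonomial.swap {p : P} {i j : ℕ} (h : HasLeadingMonomial p i j) :
    HasLeadingMonomial (swapEquiv p) j i := by
  refine ⟨by rw [coeff_swapEquiv]; exact h.1, fun a b hab => ?_⟩
  rw [coeff_swapEquiv] at hab
  have := h.2 _ _ hab
  omega

lemma HasLeadingMonomial.totalDegree_eq {p : P} {i j : ℕ} (h : HasLeadingMonomial p i j) :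
    p.totalDegree = i + j := by
  refine le_antisymm (totalDegree_le_iff_expo.2 fun a b hab => ?_)
    (totalDegree_le_iff_expo.1 le_rfl i j h.1)
  have := h.2 a b hab
  omega

lemma totalDegree_shear_le (α : ℂ) (p : P) :
    (shear (Polynomial.C α * Polynomial.X ^ 1) p).totalDegree ≤ p.totalDegree := by
  have h := weight_le_of_shear (K := 1) α (p := p) (N := p.totalDegree) (fun a b hab => by
    rw [one_mul, one_mul]
    exact totalDegree_le_iff_expo.1 le_rfl a b hab)
  exact totalDegree_le_iff_expo.2 fun a b hab => by simpa using h a b hab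

lemma exists_expo_of_totalDegree (p : P) (hp : 0 < p.totalDegree) :
    ∃ a b, coeff (expo a b) p ≠ 0 ∧ a + b = p.totalDegree := by
  by_contra! h
  have : p.totalDegree ≤ p.totalDegree - 1 := totalDegree_le_iff_expo.2 fun a b hab =>
    Nat.le_sub_one_of_lt (lt_of_le_of_ne (totalDegree_le_iff_expo.1 le_rfl a b hab) (h a b hab))
  omega

lemma HasMate.exists_shear_hasLeadingMonomial {p : P} (hm : HasMate p)
    (hn : coeff (expo p.totalDegree 0) p = 0) : ∃ (α : ℂ) (i j : ℕ),
      HasLeadingMonomial (shear (Polynomial.C α * Polynomial.X ^ 1) p) i j := by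
  have hle : ∀ a b, coeff (expo a b) p ≠ 0 → 1 * a + 1 * b ≤ p.totalDegree := fun a b hab => by
    rw [one_mul, one_mul]
    exact totalDegree_le_iff_expo.1 le_rfl a b hab
  obtain ⟨a₀, b₀, hab₀, hn₀⟩ := exists_expo_of_totalDegree p hm.totalDegree_pos
  obtain ⟨r, α, k, hr, hf⟩ := hm.exists_edge_eq_pow 1 1 p.totalDegree one_pos hm.totalDegree_pos
    hle ⟨a₀, b₀, hab₀, by rw [one_mul, one_mul, hn₀]⟩ (Or.inr ⟨rfl, rfl, hn⟩)
  have hf₂ : (weightHom 1 1 (shear (Polynomial.C α * Polynomial.X ^ 1) p)).coeff p.totalDegree =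
      Polynomial.C r * Polynomial.X ^ k := by
    rw [coeff_weightHom_shear, hf]
    simp
  have hk : k ≤ p.totalDegree := by
    obtain ⟨b, hb, -⟩ := exists_of_coeff_weightHom_ne_zero one_pos
      (p := shear (Polynomial.C α * Polynomial.X ^ 1) p) (w₁ := 1) (N := p.totalDegree) (a := k)
      (by rw [hf₂]; simpa using hr)
    omega
  have hc (a b : ℕ) (hab : a + b = p.totalDegree) :
      coeff (expo a b) (shear (Polynomial.C α * Polynomial.X ^ 1) p) = if a = k then r else 0 := by
    rw [← coeff_weightHom 1 1 one_pos, one_mul, one_mul, hab, hf₂, Polynomial.coeff_C_mul_X_pow]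
  refine ⟨α, k, p.totalDegree - k, ?_, ?_⟩
  · rw [hc _ _ (by omega), if_pos rfl]
    exact hr
  · intro a b hab
    have h1 := totalDegree_le_iff_expo.1 (totalDegree_shear_le α p) a b hab
    rcases h1.lt_or_eq with h2 | h2
    · left
      omega
    · right
      rw [hc _ _ h2] at hab
      have : a = k := by
        by_contra h3
        rw [if_neg h3] at hab
        exact hab rfl
      omega

lemma IsDegreeMinimal.exists_hasLeadingMonomial {p : P} (hp : IsDegreeMinimal p)
    (hm : HasMate p) : ∃ (τ : P ≃ₐ[ℂ] P) (i j : ℕ),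
      (τ p).totalDegree ≤ p.totalDegree ∧ HasLeadingMonomial (τ p) i j := by
  obtain ⟨τ, hτ, hn⟩ : ∃ τ : P ≃ₐ[ℂ] P, (τ p).totalDegree ≤ p.totalDegree ∧
      coeff (expo p.totalDegree 0) (τ p) = 0 := by
    by_cases h : coeff (expo p.totalDegree 0) p = 0
    · exact ⟨AlgEquiv.refl, by rw [AlgEquiv.coe_refl, id], by rwa [AlgEquiv.coe_refl, id]⟩
    · obtain ⟨α, hα⟩ := exists_shear_coeff_eq_zero 1 p _ _ hm.totalDegree_pos.ne' h
      refine ⟨(shear (Polynomial.C α * Polynomial.X ^ 1)).trans swapEquiv, ?_, ?_⟩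
      · rw [AlgEquiv.trans_apply, totalDegree_swapEquiv]
        exact totalDegree_shear_le α p
      · rw [AlgEquiv.trans_apply, coeff_swapEquiv]
        simpa only [one_mul, add_zero] using hα
  rw [le_antisymm (hp τ) hτ] at hn
  obtain ⟨α, i, j, h⟩ := (hm.map τ).exists_shear_hasLeadingMonomial hn
  refine ⟨τ.trans (shear (Polynomial.C α * Polynomial.X ^ 1)), i, j, ?_, ?_⟩
  · rw [AlgEquiv.trans_apply]
    exact (totalDegree_shear_le α (τ p)).trans hτ
  · rw [AlgEquiv.trans_apply]
    exact h

lemma HasLeadingMonomial.le_left {p : P} {i j : ℕ} (h : HasLeadingMonomial p i j)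
    (hp : IsDegreeMinimal p) (hm : HasMate p) (hij : 2 ≤ i + j) :
    ∀ a b, coeff (expo a b) p ≠ 0 → a ≤ i := by
  by_contra! hex
  obtain ⟨a₀, b₀, hab₀, hi₀⟩ := hex
  obtain ⟨m, hmem, hmin⟩ := (p.support.filter fun m => i < m 0).exists_min_image
    (fun m => ((j : ℚ) - m 1) / ((m 0 : ℚ) - i)) ⟨expo a₀ b₀, by simpa using ⟨hab₀, hi₀⟩⟩
  obtain ⟨s, t, rfl⟩ : ∃ s t, m = expo s t := ⟨m 0, m 1, (expo_eta m).symm⟩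
  simp only [Finset.mem_filter, mem_support_iff, expo_zero, expo_one, and_imp] at hmem hmin
  obtain ⟨hst, hsi⟩ := hmem
  have hlt : s + t < i + j := (h.2 s t hst).resolve_right (by omega)
  obtain ⟨w₁, rfl⟩ : ∃ w₁, j = t + w₁ := ⟨j - t, by omega⟩
  obtain ⟨w₂, rfl⟩ : ∃ w₂, s = i + w₂ := ⟨s - i, by omega⟩
  have hw₂ : 0 < w₂ := by omega
  have hw : w₂ < w₁ := by omega
  have hle : ∀ a b, coeff (expo a b) p ≠ 0 → w₁ * a + w₂ * b ≤ w₁ * i + w₂ * (t + w₁) := by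
    intro a b hab
    rcases lt_or_ge i a with hai | hai
    · have h1 := hmin (expo a b) hab (by simpa using hai)
      rw [expo_zero, expo_one, div_le_div_iff₀ (by push_cast; simpa using hw₂)
        (by rw [sub_pos]; exact_mod_cast hai)] at h1
      have h2 : ((w₁ * a + w₂ * b : ℕ) : ℚ) ≤ (w₁ * i + w₂ * (t + w₁) : ℕ) := by
        push_cast at h1 ⊢
        linarith
      exact_mod_cast h2
    · have h1 : a + b ≤ i + (t + w₁) := by
        have := h.2 a b hab
        omega
      obtain ⟨d, rfl⟩ : ∃ d, i = a + d := ⟨i - a, by omega⟩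
      have h2 : b ≤ d + (t + w₁) := by omega
      nlinarith
  have hN : 0 < w₁ * i + w₂ * (t + w₁) := by
    have : 0 < w₂ * (t + w₁) := by
      apply Nat.mul_pos <;> omega
    omega
  obtain ⟨r, α, k, hr, hf⟩ := hm.exists_edge_eq_pow w₁ w₂ _ hw₂ hN hle ⟨i, t + w₁, h.1, rfl⟩
    (Or.inl hw)
  have hfi := coeff_weightHom w₁ w₂ hw₂ p i (t + w₁)
  have hfs := coeff_weightHom w₁ w₂ hw₂ p (i + w₂) t
  rw [show w₁ * (i + w₂) + w₂ * t = w₁ * i + w₂ * (t + w₁) by ring] at hfs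
  rw [hf, coeff_C_mul_X_sub_C_pow] at hfi hfs
  rw [← hfs] at hst
  have hki : i + w₂ ≤ k := by
    by_contra! hlt
    rw [Nat.choose_eq_zero_of_lt hlt] at hst
    simp at hst
  have hα : α ≠ 0 := by
    rintro rfl
    apply h.1
    rw [← hfi, neg_zero, zero_pow (by omega)]
    simp
  have hcoef (a : ℕ) (hak : a ≤ k) :
      ((weightHom w₁ w₂ p).coeff (w₁ * i + w₂ * (t + w₁))).coeff a ≠ 0 := by
    rw [hf, coeff_C_mul_X_sub_C_pow]
    refine mul_ne_zero hr (mul_ne_zero (pow_ne_zero _ (neg_ne_zero.2 hα)) ?_)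
    exact_mod_cast (Nat.choose_pos hak).ne'
  obtain ⟨b, hb, hb0⟩ := exists_of_coeff_weightHom_ne_zero hw₂ (hcoef 0 (Nat.zero_le k))
  have hi : i = 0 := by
    by_contra hi
    have h1 : b ≤ i + (t + w₁) := by
      have := h.2 0 b hb0
      omega
    have h2 : 0 < i := Nat.pos_of_ne_zero hi
    nlinarith
  subst hi
  obtain ⟨b₁, hb₁, -⟩ := exists_of_coeff_weightHom_ne_zero hw₂ (hcoef 1 (by omega))
  obtain ⟨K, hK⟩ : w₂ ∣ w₁ := by
    have h1 : w₂ ∣ w₁ * 1 + w₂ * b₁ := by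
      rw [hb₁, mul_zero, zero_add]
      exact Dvd.intro _ rfl
    rwa [mul_one, Nat.dvd_add_left (Dvd.intro _ rfl)] at h1
  have hK2 : 2 ≤ K := by
    by_contra! hlt
    nlinarith
  have hleK : ∀ a b, coeff (expo a b) p ≠ 0 → K * a + 1 * b ≤ t + w₁ := by
    intro a b hab
    have h1 := hle a b hab
    refine Nat.le_of_mul_le_mul_left ?_ hw₂
    rw [mul_zero, zero_add] at h1
    calc w₂ * (K * a + 1 * b) = w₁ * a + w₂ * b := by rw [hK]; ring
      _ ≤ _ := h1
  rw [hfs] at hst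
  obtain ⟨β, hβ⟩ := exists_shear_coeff_eq_zero K p _ _ (by omega) hst
  rw [show K * (0 + w₂) + t = t + w₁ by rw [hK]; ring] at hβ
  have hlow : (shear (Polynomial.C β * Polynomial.X ^ K) p).totalDegree ≤ t + w₁ - 1 := by
    refine totalDegree_le_iff_expo.2 fun a b hab => ?_
    have h1 := weight_le_of_shear β hleK a b hab
    rcases Nat.eq_zero_or_pos a with rfl | ha
    · have h2 : b ≠ t + w₁ := by
        rintro rfl
        exact hab hβ
      omega
    · nlinarith [Nat.le_sub_one_of_lt (show a + b < t + w₁ by nlinarith)]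
  have h2 := hp (shear (Polynomial.C β * Polynomial.X ^ K))
  rw [h.totalDegree_eq] at h2
  omega

lemma HasLeadingMonomial.pos_left {p : P} {i j : ℕ} (h : HasLeadingMonomial p i j)
    (hm : HasMate p) (hij : 2 ≤ i + j) (hle : ∀ a b, coeff (expo a b) p ≠ 0 → a ≤ i) : 0 < i := by
  by_contra! h0
  obtain rfl : i = 0 := Nat.le_zero.1 h0
  have hx : pderiv 0 p = 0 := by
    ext m
    rw [← expo_eta m, coeff_expo_pderiv_zero, coeff_zero]
    have : coeff (expo (m 0 + 1) (m 1)) p = 0 := by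
      by_contra hne
      exact absurd (hle _ _ hne) (by omega)
    rw [this, zero_mul]
  obtain ⟨q, c, hc, hpq⟩ := hm
  rw [jacDet, hx, zero_mul, zero_sub] at hpq
  have hu : IsUnit (pderiv 1 p) := by
    apply isUnit_of_mul_isUnit_left (y := -pderiv 0 q)
    rw [mul_neg, hpq]
    exact (isUnit_iff_ne_zero.2 hc).map C
  obtain ⟨d, -, hd⟩ := exists_eq_C_of_isUnit hu
  obtain ⟨j', rfl⟩ : ∃ j', j = j' + 1 + 1 := ⟨j - 2, by omega⟩
  have h1 := coeff_expo_pderiv_one p 0 (j' + 1)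
  rw [hd, coeff_C, if_neg] at h1
  · exact mul_ne_zero h.1 (Nat.cast_add_one_ne_zero _) h1.symm
  · intro he
    have := DFunLike.congr_fun he 1
    rw [expo_one] at this
    simp at this

/-- A polynomial of minimal degree at least two with a Jacobian mate acquires a corner after an
automorphism. -/
lemma IsDegreeMinimal.exists_hasCorner {p : P} (hp : IsDegreeMinimal p) (hm : HasMate p)
    (hn : 2 ≤ p.totalDegree) : ∃ (τ : P ≃ₐ[ℂ] P) (a b : ℕ), HasCorner (τ p) a b := by
  obtain ⟨τ, i, j, hd, h⟩ := hp.exists_hasLeadingMonomial hm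
  have hij : 2 ≤ i + j := hn.trans ((hp τ).trans h.totalDegree_eq.le)
  have hτ := hp.map τ hd
  have hs : IsDegreeMinimal (swapEquiv (τ p)) := hτ.map _ (totalDegree_swapEquiv _).le
  have hmτ := hm.map τ
  have hl := h.le_left hτ hmτ hij
  have hr := h.swap.le_left hs (hmτ.map swapEquiv) (by omega)
  obtain ⟨a, rfl⟩ := Nat.exists_eq_succ_of_ne_zero (h.pos_left hmτ hij hl).ne'
  obtain ⟨b, rfl⟩ := Nat.exists_eq_succ_of_ne_zero
    (h.swap.pos_left (hmτ.map swapEquiv) (by omega) hr).ne'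
  refine ⟨τ, a, b, h.1, fun m hm => ⟨hl (m 0) (m 1) (by rwa [expo_eta]), ?_⟩⟩
  exact hr (m 1) (m 0) (by rwa [coeff_swapEquiv, expo_eta])

lemma IsTestPolynomial.of_map {p : P} (σ : P ≃ₐ[ℂ] P) (h : IsTestPolynomial (σ p)) :
    IsTestPolynomial p := by
  intro ψ hψ
  have hb := h ((σ : P →ₐ[ℂ] P).comp (ψ.comp (σ.symm : P →ₐ[ℂ] P))) (by simp [hψ])
  have he : (ψ : P → P) = σ.symm ∘ ((σ : P →ₐ[ℂ] P).comp (ψ.comp (σ.symm : P →ₐ[ℂ] P))) ∘ σ := by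
    ext1 u
    simp
  rw [he]
  exact σ.symm.bijective.comp (hb.comp σ.bijective)

lemma exists_isDegreeMinimal (p : P) : ∃ τ : P ≃ₐ[ℂ] P, IsDegreeMinimal (τ p) := by
  obtain ⟨τ, -, hτ⟩ := (measure fun τ : P ≃ₐ[ℂ] P => (τ p).totalDegree).wf.has_min Set.univ
    ⟨AlgEquiv.refl, trivial⟩
  exact ⟨τ, fun σ => not_lt.1 (hτ (τ.trans σ) trivial)⟩

lemma shear_linear {a : ℂ} (ha : a ≠ 0) (b c : ℂ) :
    shear (Polynomial.C (-(b / a)) * Polynomial.X + Polynomial.C (-(c / a)))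
      (C a * X 0 + C b * X 1 + C c) = C a * X 0 := by
  have hC (r : ℂ) (h : ℂ[X]) : shear h (C r) = C r := algHom_apply_C (shear h : P →ₐ[ℂ] P) r
  have hb : (C a * C (b / a) : P) = C b := by rw [← C_mul, mul_div_cancel₀ _ ha]
  have hc : (C a * C (c / a) : P) = C c := by rw [← C_mul, mul_div_cancel₀ _ ha]
  simp only [map_add, map_mul, hC, shear_X_zero, shear_X_one, Polynomial.aeval_C,
    Polynomial.aeval_X, algebraMap_eq, map_neg]
  linear_combination -X 1 * hb - hc

/-- A polynomial of degree one is a coordinate. -/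
lemma exists_algEquiv_eq_C_mul_X {p : P} (h₀ : 0 < p.totalDegree) (h₁ : p.totalDegree ≤ 1) :
    ∃ (σ : P ≃ₐ[ℂ] P) (a : ℂ), a ≠ 0 ∧ σ p = C a * X 0 := by
  obtain ⟨a, b, c, rfl⟩ := exists_eq_linear_of_totalDegree_le_one p h₁
  by_cases ha : a = 0
  · subst ha
    have hb : b ≠ 0 := by
      rintro rfl
      simp at h₀
    refine ⟨swapEquiv.trans
      (shear (Polynomial.C (-(0 / b)) * Polynomial.X + Polynomial.C (-(c / b)))), b, hb, ?_⟩
    rw [AlgEquiv.trans_apply, ← shear_linear hb 0 c]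
    have hC (r : ℂ) : swapEquiv (C r) = C r := algHom_apply_C (swapEquiv : P →ₐ[ℂ] P) r
    congr 1
    simp only [map_add, map_mul, hC, swapEquiv_X_zero, swapEquiv_X_one]
    ring
  · exact ⟨_, a, ha, shear_linear ha b c⟩

lemma mem_subalgebra_of_pderiv_one_eq_zero {A : Subalgebra ℂ P} (hA : X 0 ∈ A) {w : P}
    (hw : pderiv 1 w = 0) : w ∈ A := by
  rw [w.as_sum]
  refine sum_mem fun m hm => ?_
  have hm₁ : m 1 = 0 := by
    by_contra h
    obtain ⟨k, hk⟩ := Nat.exists_eq_succ_of_ne_zero h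
    have h1 := coeff_expo_pderiv_one w (m 0) k
    rw [hw, coeff_zero, ← Nat.succ_eq_add_one k, ← hk, expo_eta] at h1
    exact mul_ne_zero (mem_support_iff.1 hm) (Nat.cast_add_one_ne_zero k) h1.symm
  rw [monomial_eq, Finsupp.prod_fintype _ _ (fun _ => pow_zero _), Fin.prod_univ_two, hm₁,
    pow_zero, mul_one, ← algebraMap_eq]
  exact mul_mem (A.algebraMap_mem _) (pow_mem hA _)

lemma bijective_of_X_zero {ψ : P →ₐ[ℂ] P} {a c : ℂ} (ha : a ≠ 0) (hc : c ≠ 0)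
    (h₀ : ψ (X 0) = C a * X 0) (hψ : jacDet (ψ (X 0)) (ψ (X 1)) = C c) :
    Function.Bijective ψ := by
  have hunit (e : ℂ) (he : e ≠ 0) (u : P) (hu : C e * u ∈ ψ.range) : u ∈ ψ.range := by
    have : u = C e⁻¹ * (C e * u) := by
      rw [← mul_assoc, ← C_mul, inv_mul_cancel₀ he, C_1, one_mul]
    rw [this]
    exact mul_mem (ψ.range.algebraMap_mem _) hu
  have hX₀ : X 0 ∈ ψ.range := hunit a ha _ ⟨X 0, h₀⟩
  have hd : C a * pderiv 1 (ψ (X 1)) = C c := by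
    simpa [jacDet, h₀, pderiv_X] using hψ
  refine bijective_of_surjective_algHom (surjective_of_X_mem_range hX₀ ?_)
  refine hunit c hc _ ?_
  have hw : pderiv 1 (C c * X 1 - C a * ψ (X 1)) = 0 := by
    simp [hd]
  have := add_mem (mem_subalgebra_of_pderiv_one_eq_zero hX₀ hw)
    (mul_mem (ψ.range.algebraMap_mem a) (ψ.mem_range_self (X 1)))
  rwa [algebraMap_eq, sub_add_cancel] at this

/-- If `φ` is a `ℂ`-algebra endomorphism of `ℂ[x,y]` with invertible Jacobian
matrix which is not an automorphism (a counterexample to the Jacobian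
conjecture), then `φ(x)` is a test polynomial. -/
theorem counterexample_image_of_x_is_test (φ : P →ₐ[ℂ] P)
    (hjac : ∃ c : ℂ, c ≠ 0 ∧ jacDet (φ (X 0)) (φ (X 1)) = C c)
    (hnaut : ¬Function.Bijective φ) :
    IsTestPolynomial (φ (X 0)) := by
  obtain ⟨c, hc, hφ⟩ := hjac
  have hm : HasMate (φ (X 0)) := ⟨φ (X 1), c, hc, hφ⟩
  obtain ⟨τ, hτ⟩ := exists_isDegreeMinimal (φ (X 0))
  have hmτ := hm.map τ
  rcases le_or_gt (τ (φ (X 0))).totalDegree 1 with h1 | h2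
  · obtain ⟨σ, a, ha, hσ⟩ := exists_algEquiv_eq_C_mul_X hmτ.totalDegree_pos h1
    let ρ : P ≃ₐ[ℂ] P := τ.trans σ
    obtain ⟨d, hd, hρ⟩ := jacDet_algEquiv ρ
    have hb : Function.Bijective ((ρ : P →ₐ[ℂ] P).comp φ) := by
      refine bijective_of_X_zero ha (mul_ne_zero hc hd) hσ ?_
      have h := jacDet_algHom (ρ : P →ₐ[ℂ] P) (φ (X 0)) (φ (X 1))
      rw [hφ, algHom_apply_C] at h
      rw [C_mul, ← hρ]
      exact h
    exact absurd ((Function.Bijective.of_comp_iff' ρ.bijective φ).1 hb) hnaut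
  · obtain ⟨σ, a, b, h⟩ := hτ.exists_hasCorner hmτ h2
    exact ((h.isTestPolynomial (hmτ.map σ)).of_map σ).of_map τ
end
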